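/- arXiv:1207.5363 — 2 statements merged into one kernel-verified Lean document; each statement's English description precedes it below -/
import Mathlib

section
/- Let H be a cocommutative weak Hopf algebra over a commutative ring k and (A, φ_A) a weak left H-module algebra. Then the following are equivalent: (i) (A, φ_A) is a left H-module algebra (i.e. φ_A∘(μ_H⊗A)=φ_A∘(H⊗φ_A)); (ii) (φ_A, u₂) is a crossed system for H over A, where u₂ = u₁∘μ_H with u₁ = φ_A∘(H⊗η_A). -/
open TensorProduct

noncomputable section

namespace WHA

variable (k : Type) [CommRing k]

/-- Generalized convolution product of two linear maps from a "coalgebra"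
(given by a comultiplication `δC`) to a module `P` with a product `m`. -/
def convG {C P : Type} [AddCommGroup C] [Module k C] [AddCommGroup P] [Module k P]
    (δC : C →ₗ[k] C ⊗[k] C) (m : P ⊗[k] P →ₗ[k] P) (f g : C →ₗ[k] P) : C →ₗ[k] P :=
  m ∘ₗ TensorProduct.map f g ∘ₗ δC

/-- Convolution product of two linear maps from a "coalgebra" to an algebra. -/
def conv {C A : Type} [AddCommGroup C] [Module k C] [Ring A] [Algebra k A]
    (δC : C →ₗ[k] C ⊗[k] C) (f g : C →ₗ[k] A) : C →ₗ[k] A :=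
  convG k δC (LinearMap.mul' k A) f g

variable (H : Type) [Ring H] [Algebra k H]

/-- The structure maps (comultiplication, counit, antipode) of a prospective
weak Hopf algebra on the `k`-algebra `H`. -/
structure HopfData where
  δ : H →ₗ[k] H ⊗[k] H
  ε : H →ₗ[k] k
  lam : H →ₗ[k] H

variable {k H}

/-- The target map `Π^L_H = ((ε∘μ)⊗H)∘(H⊗c)∘((δ∘η)⊗H)`. -/
def PiL (W : HopfData k H) : H →ₗ[k] H :=
  (TensorProduct.rid k H).toLinearMap
    ∘ₗ LinearMap.lTensor H (W.ε ∘ₗ LinearMap.mul' k H)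
    ∘ₗ (TensorProduct.assoc k H H H).toLinearMap
    ∘ₗ LinearMap.rTensor H (TensorProduct.comm k H H).toLinearMap
    ∘ₗ TensorProduct.mk k (H ⊗[k] H) H (W.δ 1)

/-- The source map `Π^R_H = (H⊗(ε∘μ))∘(c⊗H)∘(H⊗(δ∘η))`. -/
def PiR (W : HopfData k H) : H →ₗ[k] H :=
  (TensorProduct.lid k H).toLinearMap
    ∘ₗ LinearMap.rTensor H (W.ε ∘ₗ LinearMap.mul' k H)
    ∘ₗ (TensorProduct.assoc k H H H).symm.toLinearMap
    ∘ₗ LinearMap.lTensor H (TensorProduct.comm k H H).toLinearMap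
    ∘ₗ (TensorProduct.mk k H (H ⊗[k] H)).flip (W.δ 1)

/-- `H` together with the data `W` is a weak Hopf algebra. -/
structure IsWeakHopf (W : HopfData k H) : Prop where
  coassoc : ∀ h : H,
    (TensorProduct.assoc k H H H) ((LinearMap.rTensor H W.δ) (W.δ h)) =
      (LinearMap.lTensor H W.δ) (W.δ h)
  counit_left : ∀ h : H, (TensorProduct.lid k H) ((LinearMap.rTensor H W.ε) (W.δ h)) = h
  counit_right : ∀ h : H, (TensorProduct.rid k H) ((LinearMap.lTensor H W.ε) (W.δ h)) = h
  a1 : ∀ x y : H, W.δ (x * y) = W.δ x * W.δ y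
  a2 : ∀ x y z : H, W.ε (x * y * z) =
    LinearMap.mul' k k ((TensorProduct.map (W.ε ∘ₗ LinearMap.mulLeft k x)
      (W.ε ∘ₗ LinearMap.mulRight k z)) (W.δ y))
  a2' : ∀ x y z : H, W.ε (x * y * z) =
    LinearMap.mul' k k ((TensorProduct.map (W.ε ∘ₗ LinearMap.mulLeft k x)
      (W.ε ∘ₗ LinearMap.mulRight k z)) ((TensorProduct.comm k H H) (W.δ y)))
  a3 : (TensorProduct.assoc k H H H) ((LinearMap.rTensor H W.δ) (W.δ 1)) =
    (TensorProduct.map LinearMap.id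
        (Algebra.TensorProduct.includeLeft : H →ₐ[k] H ⊗[k] H).toLinearMap) (W.δ 1) *
      (Algebra.TensorProduct.includeRight : (H ⊗[k] H) →ₐ[k] H ⊗[k] (H ⊗[k] H)).toLinearMap
        (W.δ 1)
  a3' : (TensorProduct.assoc k H H H) ((LinearMap.rTensor H W.δ) (W.δ 1)) =
    (Algebra.TensorProduct.includeRight : (H ⊗[k] H) →ₐ[k] H ⊗[k] (H ⊗[k] H)).toLinearMap
        (W.δ 1) *
      (TensorProduct.map LinearMap.id
        (Algebra.TensorProduct.includeLeft : H →ₐ[k] H ⊗[k] H).toLinearMap) (W.δ 1)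
  a4_left : ∀ h : H,
    LinearMap.mul' k H ((TensorProduct.map LinearMap.id W.lam) (W.δ h)) = PiL W h
  a4_right : ∀ h : H,
    LinearMap.mul' k H ((TensorProduct.map W.lam LinearMap.id) (W.δ h)) = PiR W h
  a4_mid : conv k W.δ (conv k W.δ W.lam LinearMap.id) W.lam = W.lam

/-- `H` is cocommutative. -/
def Cocomm (W : HopfData k H) : Prop :=
  ∀ h : H, (TensorProduct.comm k H H) (W.δ h) = W.δ h

section ComodAlg

variable {A : Type} [Ring A] [Algebra k A]

/-- The map `ζ_A = (μ_A⊗H)∘(A⊗c_{H,A})∘((ρ_A∘η_A)⊗A)`; in the tensor product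
algebra `A ⊗ H` it is given by `a ↦ ρ(1) * (a ⊗ 1)`. -/
def zeta (ρ : A →ₗ[k] A ⊗[k] H) (a : A) : A ⊗[k] H :=
  ρ 1 * (a ⊗ₜ[k] (1 : H))

/-- `a` is a coinvariant element, i.e. belongs to `A_H`. -/
def IsCoinv (ρ : A →ₗ[k] A ⊗[k] H) (a : A) : Prop :=
  ρ a = zeta ρ a

/-- `(A, ρ)` is a right `H`-comodule algebra. -/
structure IsComodAlg (W : HopfData k H) (ρ : A →ₗ[k] A ⊗[k] H) : Prop where
  coassoc : ∀ a : A, (TensorProduct.assoc k A H H) ((LinearMap.rTensor H ρ) (ρ a)) =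
    (LinearMap.lTensor A W.δ) (ρ a)
  counit : ∀ a : A, (TensorProduct.rid k A) ((LinearMap.lTensor A W.ε) (ρ a)) = a
  mul_compat : ∀ a b : A, ρ (a * b) = ρ a * ρ b
  unit_coinv : (LinearMap.lTensor A (PiL W)) (ρ 1) = ρ 1

end ComodAlg

/-- For `t = Σ x ⊗ y : B ⊗ H`, the map `h ↦ Σ ε(h*y) • x`.  For
`t = ρ(1)` this is the map `e_A = (A⊗ε)∘Γ∘(H⊗η)`. -/
def eGen (W : HopfData k H) {B : Type} [AddCommGroup B] [Module k B]
    (t : B ⊗[k] H) : H →ₗ[k] B :=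
  (TensorProduct.lid k B).toLinearMap
    ∘ₗ LinearMap.rTensor B (W.ε ∘ₗ LinearMap.mul' k H)
    ∘ₗ (TensorProduct.assoc k H H B).symm.toLinearMap
    ∘ₗ LinearMap.lTensor H (TensorProduct.comm k B H).toLinearMap
    ∘ₗ (TensorProduct.mk k H (B ⊗[k] H)).flip t

/-- For `t = Σ x ⊗ y : B ⊗ H`, the map `h ↦ Σ ε(y*h) • x`.  For
`t = ρ(1)` this is the map `(A⊗(ε∘μ))∘((ρ∘η)⊗H)`. -/
def dGen (W : HopfData k H) {B : Type} [AddCommGroup B] [Module k B]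
    (t : B ⊗[k] H) : H →ₗ[k] B :=
  (TensorProduct.rid k B).toLinearMap
    ∘ₗ LinearMap.lTensor B (W.ε ∘ₗ LinearMap.mul' k H)
    ∘ₗ (TensorProduct.assoc k B H H).toLinearMap
    ∘ₗ TensorProduct.mk k (B ⊗[k] H) H t

section ComodAlg2

variable {A : Type} [Ring A] [Algebra k A]

/-- The entwining map `Γ_A^H = (A⊗μ_H)∘(c_{H,A}⊗H)∘(H⊗ρ_A)`. -/
def Γmap (ρ : A →ₗ[k] A ⊗[k] H) : H ⊗[k] A →ₗ[k] A ⊗[k] H :=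
  LinearMap.lTensor A (LinearMap.mul' k H)
    ∘ₗ (TensorProduct.assoc k A H H).toLinearMap
    ∘ₗ LinearMap.rTensor H (TensorProduct.comm k H A).toLinearMap
    ∘ₗ (TensorProduct.assoc k H A H).symm.toLinearMap
    ∘ₗ LinearMap.lTensor H ρ

/-- `f : H → A` is an integral, i.e. a morphism of right `H`-comodules. -/
def IsIntegral (W : HopfData k H) (ρ : A →ₗ[k] A ⊗[k] H) (f : H →ₗ[k] A) : Prop :=
  ∀ h : H, ρ (f h) = (LinearMap.rTensor H f) (W.δ h)

/-- `finv` is the convolution inverse of the integral `f` (conditions (c1)-(c3)). -/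
def IsConvInv (W : HopfData k H) (ρ : A →ₗ[k] A ⊗[k] H) (f finv : H →ₗ[k] A) : Prop :=
  conv k W.δ finv f = eGen W (ρ 1) ∧
  conv k W.δ f finv = dGen W (ρ 1) ∧
  conv k W.δ (conv k W.δ finv f) finv = finv

/-- `f` is a cleaving morphism (with convolution inverse `finv`) for the extension
`A_H ↪ A`, i.e. a convolution invertible integral such that `f ∧ f⁻¹` takes
values in the coinvariants. -/
def IsCleaving (W : HopfData k H) (ρ : A →ₗ[k] A ⊗[k] H) (f finv : H →ₗ[k] A) : Prop :=
  IsIntegral W ρ f ∧ IsConvInv W ρ f finv ∧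
    ∀ h : H, IsCoinv ρ (conv k W.δ f finv h)

end ComodAlg2

section ModAlg

variable {B : Type} [Ring B] [Algebra k B]

/-- `u₁ = φ ∘ (H ⊗ η_B)`. -/
def u1 (φ : H ⊗[k] B →ₗ[k] B) : H →ₗ[k] B :=
  φ ∘ₗ (TensorProduct.mk k H B).flip 1

/-- `u₂ = u₁ ∘ μ_H`. -/
def u2 (φ : H ⊗[k] B →ₗ[k] B) : H ⊗[k] H →ₗ[k] B :=
  u1 φ ∘ₗ LinearMap.mul' k H

/-- `(B, φ)` is a weak left `H`-module algebra (conditions (d1)-(d4)). -/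
def IsWeakModAlg (W : HopfData k H) (φ : H ⊗[k] B →ₗ[k] B) : Prop :=
  (∀ b : B, φ ((1 : H) ⊗ₜ[k] b) = b) ∧
  (∀ (h : H) (b c : B), φ (h ⊗ₜ[k] (b * c)) =
    LinearMap.mul' k B ((TensorProduct.map (φ ∘ₗ (TensorProduct.mk k H B).flip b)
      (φ ∘ₗ (TensorProduct.mk k H B).flip c)) (W.δ h))) ∧
  (∀ g h : H, φ ((g * h) ⊗ₜ[k] (1 : B)) = φ (g ⊗ₜ[k] φ (h ⊗ₜ[k] (1 : B)))) ∧
  (∀ (h : H) (b : B), φ (PiL W h ⊗ₜ[k] b) = φ (h ⊗ₜ[k] (1 : B)) * b)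

/-- `(B, φ)` is a left `H`-module algebra. -/
def IsModAlg (W : HopfData k H) (φ : H ⊗[k] B →ₗ[k] B) : Prop :=
  IsWeakModAlg W φ ∧
    ∀ (g h : H) (b : B), φ ((g * h) ⊗ₜ[k] b) = φ (g ⊗ₜ[k] φ (h ⊗ₜ[k] b))

/-- `(h, hinv)` is a pair of mutually convolution inverse elements in
`Reg_{φ}(H,B)`. -/
def IsRegPair (W : HopfData k H) (φ : H ⊗[k] B →ₗ[k] B) (h hinv : H →ₗ[k] B) : Prop :=
  conv k W.δ h hinv = u1 φ ∧ conv k W.δ hinv h = u1 φ ∧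
  conv k W.δ (conv k W.δ h hinv) h = h ∧
  conv k W.δ (conv k W.δ hinv h) hinv = hinv

end ModAlg

/-- The comultiplication of the tensor product coalgebra `H ⊗ H`. -/
def δ2 (W : HopfData k H) : H ⊗[k] H →ₗ[k] (H ⊗[k] H) ⊗[k] (H ⊗[k] H) :=
  (TensorProduct.tensorTensorTensorComm k H H H H).toLinearMap
    ∘ₗ TensorProduct.map W.δ W.δ

/-- The comultiplication of the tensor product coalgebra `H ⊗ (H ⊗ H)`. -/
def δ3 (W : HopfData k H) :
    H ⊗[k] (H ⊗[k] H) →ₗ[k] (H ⊗[k] (H ⊗[k] H)) ⊗[k] (H ⊗[k] (H ⊗[k] H)) :=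
  (TensorProduct.tensorTensorTensorComm k H H (H ⊗[k] H) (H ⊗[k] H)).toLinearMap
    ∘ₗ TensorProduct.map W.δ (δ2 W)

section ModAlg2

variable {B : Type} [Ring B] [Algebra k B]

/-- `(σ, σinv)` is a pair of mutually convolution inverse elements in
`Reg_{φ}(H⊗H,B)`. -/
def IsRegPair2 (W : HopfData k H) (φ : H ⊗[k] B →ₗ[k] B)
    (σ σinv : H ⊗[k] H →ₗ[k] B) : Prop :=
  conv k (δ2 W) σ σinv = u2 φ ∧ conv k (δ2 W) σinv σ = u2 φ ∧
  conv k (δ2 W) (conv k (δ2 W) σ σinv) σ = σ ∧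
  conv k (δ2 W) (conv k (δ2 W) σinv σ) σinv = σinv

/-- Condition (g1) (the twisted condition). -/
def CrossedG1 (W : HopfData k H) (φ : H ⊗[k] B →ₗ[k] B) (σ : H ⊗[k] H →ₗ[k] B) : Prop :=
  ∀ (x y : H) (b : B),
    LinearMap.mul' k B ((TensorProduct.map σ
        ((φ ∘ₗ (TensorProduct.mk k H B).flip b) ∘ₗ LinearMap.mul' k H))
      (δ2 W (x ⊗ₜ[k] y))) =
    LinearMap.mul' k B ((TensorProduct.map
        (φ ∘ₗ LinearMap.lTensor H (φ ∘ₗ (TensorProduct.mk k H B).flip b)) σ)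
      (δ2 W (x ⊗ₜ[k] y)))

/-- Condition (g2) (the cocycle condition). -/
def CrossedG2 (W : HopfData k H) (φ : H ⊗[k] B →ₗ[k] B) (σ : H ⊗[k] H →ₗ[k] B) : Prop :=
  conv k (δ3 W) (φ ∘ₗ LinearMap.lTensor H σ)
      (σ ∘ₗ LinearMap.lTensor H (LinearMap.mul' k H)) =
  conv k (δ3 W)
      ((TensorProduct.rid k B).toLinearMap ∘ₗ TensorProduct.map σ W.ε
        ∘ₗ (TensorProduct.assoc k H H H).symm.toLinearMap)
      (σ ∘ₗ LinearMap.rTensor H (LinearMap.mul' k H)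
        ∘ₗ (TensorProduct.assoc k H H H).symm.toLinearMap)

/-- Condition (g3) (the normal condition). -/
def CrossedG3 (W : HopfData k H) (φ : H ⊗[k] B →ₗ[k] B) (σ : H ⊗[k] H →ₗ[k] B) : Prop :=
  ∀ h : H, σ (h ⊗ₜ[k] (1 : H)) = u1 φ h ∧ σ ((1 : H) ⊗ₜ[k] h) = u1 φ h

/-- `(φ, σ)` is a crossed system for `H` over `B`, with `σinv` the convolution
inverse of `σ`. -/
def IsCrossedSystem (W : HopfData k H) (φ : H ⊗[k] B →ₗ[k] B)
    (σ σinv : H ⊗[k] H →ₗ[k] B) : Prop :=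
  IsWeakModAlg W φ ∧ IsRegPair2 W φ σ σinv ∧
    CrossedG1 W φ σ ∧ CrossedG2 W φ σ ∧ CrossedG3 W φ σ

/-- The condition that `h` conjugates the weak action `ϕ` into `φ`. -/
def FisEq (W : HopfData k H) (φ ϕ : H ⊗[k] B →ₗ[k] B) (h hinv : H →ₗ[k] B) : Prop :=
  ∀ (g : H) (b : B), φ (g ⊗ₜ[k] b) =
    (LinearMap.mul' k B ∘ₗ LinearMap.rTensor B (LinearMap.mul' k B))
      ((TensorProduct.map (TensorProduct.map h (ϕ ∘ₗ (TensorProduct.mk k H B).flip b)) hinv)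
        ((LinearMap.rTensor H W.δ) (W.δ g)))

/-- The condition that `h` transforms the cocycle `τ` into `σ`. -/
def SigmasEq (W : HopfData k H) (ϕ : H ⊗[k] B →ₗ[k] B)
    (σ τ : H ⊗[k] H →ₗ[k] B) (h hinv : H →ₗ[k] B) : Prop :=
  σ = conv k (δ2 W)
    (LinearMap.mul' k B ∘ₗ TensorProduct.map h ϕ
      ∘ₗ (TensorProduct.assoc k H H B).toLinearMap ∘ₗ TensorProduct.map W.δ h)
    (conv k (δ2 W) τ (hinv ∘ₗ LinearMap.mul' k H))

/-- `h` (with convolution inverse `hinv`) realizes an equivalence between the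
crossed systems `(φ, σ)` and `(ϕ, τ)`. -/
def RealizesEquiv (W : HopfData k H) (φ ϕ : H ⊗[k] B →ₗ[k] B)
    (σ τ : H ⊗[k] H →ₗ[k] B) (h hinv : H →ₗ[k] B) : Prop :=
  IsRegPair W φ h hinv ∧ IsRegPair W ϕ h hinv ∧ h 1 = 1 ∧
    FisEq W φ ϕ h hinv ∧ SigmasEq W ϕ σ τ h hinv

/-- The crossed systems `(φ, σ)` and `(ϕ, τ)` are equivalent. -/
def CrossedEquiv (W : HopfData k H) (φ ϕ : H ⊗[k] B →ₗ[k] B)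
    (σ τ : H ⊗[k] H →ₗ[k] B) : Prop :=
  u1 φ = u1 ϕ ∧ ∃ h hinv : H →ₗ[k] B, RealizesEquiv W φ ϕ σ τ h hinv

/-- The map `ψ_H^B = (φ⊗H)∘(H⊗c_{H,B})∘(δ_H⊗B)`. -/
def ψmap (W : HopfData k H) (φ : H ⊗[k] B →ₗ[k] B) : H ⊗[k] B →ₗ[k] B ⊗[k] H :=
  LinearMap.rTensor H φ
    ∘ₗ (TensorProduct.assoc k H B H).symm.toLinearMap
    ∘ₗ LinearMap.lTensor H (TensorProduct.comm k H B).toLinearMap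
    ∘ₗ (TensorProduct.assoc k H H B).toLinearMap
    ∘ₗ LinearMap.rTensor B W.δ

/-- The map `σ_H^B = (σ⊗μ_H)∘δ_{H⊗H}`. -/
def σHA (W : HopfData k H) (σ : H ⊗[k] H →ₗ[k] B) : H ⊗[k] H →ₗ[k] B ⊗[k] H :=
  TensorProduct.map σ (LinearMap.mul' k H) ∘ₗ δ2 W

/-- The idempotent `∇_{B⊗H} = (μ_B⊗H)∘(B⊗ψ_H^B)∘(B⊗H⊗η_B)`. -/
def nabla (W : HopfData k H) (φ : H ⊗[k] B →ₗ[k] B) : B ⊗[k] H →ₗ[k] B ⊗[k] H :=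
  LinearMap.rTensor H (LinearMap.mul' k B)
    ∘ₗ (TensorProduct.assoc k B B H).symm.toLinearMap
    ∘ₗ LinearMap.lTensor B (ψmap W φ)
    ∘ₗ LinearMap.lTensor B ((TensorProduct.mk k H B).flip 1)

/-- The product `(μ_B⊗H)∘(μ_B⊗σ_H^B)∘(B⊗ψ_H^B⊗H)` on `B ⊗ H`. -/
def crossmulAmb (W : HopfData k H) (φ : H ⊗[k] B →ₗ[k] B) (σ : H ⊗[k] H →ₗ[k] B) :
    (B ⊗[k] H) ⊗[k] (B ⊗[k] H) →ₗ[k] B ⊗[k] H :=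
  LinearMap.rTensor H (LinearMap.mul' k B)
    ∘ₗ (TensorProduct.assoc k B B H).symm.toLinearMap
    ∘ₗ LinearMap.lTensor B (LinearMap.rTensor H (LinearMap.mul' k B))
    ∘ₗ LinearMap.lTensor B ((TensorProduct.assoc k B B H).symm.toLinearMap)
    ∘ₗ LinearMap.lTensor B (LinearMap.lTensor B (σHA W σ))
    ∘ₗ LinearMap.lTensor B ((TensorProduct.assoc k B H H).toLinearMap)
    ∘ₗ LinearMap.lTensor B (LinearMap.rTensor H (ψmap W φ))
    ∘ₗ LinearMap.lTensor B ((TensorProduct.assoc k H B H).symm.toLinearMap)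
    ∘ₗ (TensorProduct.assoc k B H (B ⊗[k] H)).toLinearMap

end ModAlg2

section CrossProd

variable {B : Type} [Ring B] [Algebra k B]
variable {P : Type} [AddCommGroup P] [Module k P]

/-- The product of the weak crossed product `B ×_σ H`, through a splitting
`(P, p, ι)` of the idempotent `∇_{B⊗H}`. -/
def crossMul (W : HopfData k H) (φ : H ⊗[k] B →ₗ[k] B) (σ : H ⊗[k] H →ₗ[k] B)
    (p : B ⊗[k] H →ₗ[k] P) (ι : P →ₗ[k] B ⊗[k] H) : P ⊗[k] P →ₗ[k] P :=
  p ∘ₗ crossmulAmb W φ σ ∘ₗ TensorProduct.map ι ι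

/-- The unit of the weak crossed product `B ×_σ H`. -/
def crossUnit (W : HopfData k H) (φ : H ⊗[k] B →ₗ[k] B)
    (p : B ⊗[k] H →ₗ[k] P) : P :=
  p (nabla W φ ((1 : B) ⊗ₜ[k] (1 : H)))

/-- The coaction `ρ_{B×H} = (p⊗H)∘(B⊗δ_H)∘ι` of the weak crossed product. -/
def crossCoact (W : HopfData k H)
    (p : B ⊗[k] H →ₗ[k] P) (ι : P →ₗ[k] B ⊗[k] H) : P →ₗ[k] P ⊗[k] H :=
  LinearMap.rTensor H p ∘ₗ (TensorProduct.assoc k B H H).symm.toLinearMap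
    ∘ₗ LinearMap.lTensor B W.δ ∘ₗ ι

/-- The inclusion `i_{B×H} = p∘(B⊗η_H) : B → B × H`. -/
def crossInc (p : B ⊗[k] H →ₗ[k] P) : B →ₗ[k] P :=
  p ∘ₗ (TensorProduct.mk k B H).flip 1

/-- The analogue of `ζ` for an abstract module `P` with product `m`:
`ζ(x) = t · (x ⊗ 1)` where `t` plays the role of `ρ(1)`. -/
def zetaGen (m : P ⊗[k] P →ₗ[k] P) (t : P ⊗[k] H) (x : P) : P ⊗[k] H :=
  (TensorProduct.map m (LinearMap.mul' k H))
    ((TensorProduct.tensorTensorTensorComm k P H P H) (t ⊗ₜ[k] (x ⊗ₜ[k] (1 : H))))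

end CrossProd

section Induced

variable {D P : Type} [AddCommGroup D] [Module k D] [AddCommGroup P] [Module k P]

/-- The map `(P⊗P)⊗P → P`, `(x⊗y)⊗z ↦ x·(z·y)`. -/
def mulSwizG (m : P ⊗[k] P →ₗ[k] P) : (P ⊗[k] P) ⊗[k] P →ₗ[k] P :=
  m ∘ₗ LinearMap.lTensor P (m ∘ₗ (TensorProduct.comm k P P).toLinearMap)
    ∘ₗ (TensorProduct.assoc k P P P).toLinearMap

/-- The ambient weak action `μ∘(P⊗(μ∘c))∘(((f⊗f⁻¹)∘δ_H)⊗j) : H ⊗ D → P`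
induced by a cleaving morphism `f`. -/
def phiAmb (W : HopfData k H) (m : P ⊗[k] P →ₗ[k] P) (f finv : H →ₗ[k] P)
    (j : D →ₗ[k] P) : H ⊗[k] D →ₗ[k] P :=
  mulSwizG m ∘ₗ TensorProduct.map ((TensorProduct.map f finv) ∘ₗ W.δ) j

/-- The ambient cocycle `(μ∘(f⊗f)) ∧ (f⁻¹∘μ_H) : H ⊗ H → P` induced by a
cleaving morphism `f`. -/
def sigmaAmb (W : HopfData k H) (m : P ⊗[k] P →ₗ[k] P) (f finv : H →ₗ[k] P) :
    H ⊗[k] H →ₗ[k] P :=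
  convG k (δ2 W) m (m ∘ₗ TensorProduct.map f f) (finv ∘ₗ LinearMap.mul' k H)

end Induced

section Pres

variable {A D : Type} [Ring A] [Algebra k A] [Ring D] [Algebra k D]

/-- `j : D → A` presents `D` as the subalgebra of coinvariants of `A`. -/
def IsCoinvPres (ρ : A →ₗ[k] A ⊗[k] H) (j : D →ₐ[k] A) : Prop :=
  Function.Injective j ∧ ∀ a : A, IsCoinv ρ a ↔ a ∈ Set.range j

end Pres

section StrictAction

variable {A : Type} [Ring A] [Algebra k A]

/-- Multiplying in both legs of the tensor product coalgebra is the product of `H ⊗ H`. -/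
theorem map_mul'_tensorTensorTensorComm (s t : H ⊗[k] H) :
    TensorProduct.map (LinearMap.mul' k H) (LinearMap.mul' k H)
      (TensorProduct.tensorTensorTensorComm k H H H H (s ⊗ₜ[k] t)) = s * t := by
  induction s with
  | zero => simp
  | add a b ha hb => simp only [TensorProduct.add_tmul, map_add, ha, hb, add_mul]
  | tmul a b =>
    induction t with
    | zero => simp
    | add c d hc hd => simp only [TensorProduct.tmul_add, map_add, hc, hd, mul_add]
    | tmul c d => simp

/-- Precomposition with the product of `H` turns convolution over `H` into
convolution over `H ⊗ H`. -/
theorem conv_comp_mul' {W : HopfData k H} (hW : IsWeakHopf W) (f g : H →ₗ[k] A) :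
    conv k (δ2 W) (f ∘ₗ LinearMap.mul' k H) (g ∘ₗ LinearMap.mul' k H) =
      conv k W.δ f g ∘ₗ LinearMap.mul' k H := by
  refine TensorProduct.ext' fun x y => ?_
  simp only [conv, convG, δ2, LinearMap.comp_apply, TensorProduct.map_tmul,
    LinearEquiv.coe_coe, TensorProduct.map_comp, LinearMap.mul'_apply, hW.a1,
    map_mul'_tensorTensorTensorComm]

variable {W : HopfData k H} {φ : H ⊗[k] A →ₗ[k] A}

theorem u1_mul (hφ : IsWeakModAlg W φ) (g h : H) : u1 φ (g * h) = φ (g ⊗ₜ[k] u1 φ h) := by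
  simpa [u1] using hφ.2.2.1 g h

theorem u2_eq_comp_lTensor (hφ : IsWeakModAlg W φ) : u2 φ = φ ∘ₗ LinearMap.lTensor H (u1 φ) :=
  TensorProduct.ext' fun x y => by simpa [u2] using u1_mul hφ x y

theorem conv_act (hφ : IsWeakModAlg W φ) (b c : A) :
    conv k W.δ (φ ∘ₗ (TensorProduct.mk k H A).flip b) (φ ∘ₗ (TensorProduct.mk k H A).flip c) =
      φ ∘ₗ (TensorProduct.mk k H A).flip (b * c) :=
  LinearMap.ext fun h => (hφ.2.1 h b c).symm

theorem conv_u1_act (hφ : IsWeakModAlg W φ) (b : A) :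
    conv k W.δ (u1 φ) (φ ∘ₗ (TensorProduct.mk k H A).flip b) =
      φ ∘ₗ (TensorProduct.mk k H A).flip b := by
  simpa [u1] using conv_act hφ 1 b

theorem conv_act_u1 (hφ : IsWeakModAlg W φ) (b : A) :
    conv k W.δ (φ ∘ₗ (TensorProduct.mk k H A).flip b) (u1 φ) =
      φ ∘ₗ (TensorProduct.mk k H A).flip b := by
  simpa [u1] using conv_act hφ b 1

theorem conv_u2_u2 (hW : IsWeakHopf W) (hφ : IsWeakModAlg W φ) :
    conv k (δ2 W) (u2 φ) (u2 φ) = u2 φ := by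
  have h : conv k W.δ (u1 φ) (u1 φ) = u1 φ := conv_u1_act hφ 1
  rw [u2, conv_comp_mul' hW, h]

/-- The action on a product of values, spread over the tensor product comultiplication. -/
theorem mul'_map_act_lTensor (hφ : IsWeakModAlg W φ) {M : Type} [AddCommGroup M] [Module k M]
    (f g : M →ₗ[k] A) (x : H) (t : M ⊗[k] M) :
    LinearMap.mul' k A (TensorProduct.map (φ ∘ₗ LinearMap.lTensor H f) (φ ∘ₗ LinearMap.lTensor H g)
      (TensorProduct.tensorTensorTensorComm k H H M M (W.δ x ⊗ₜ[k] t))) =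
    φ (x ⊗ₜ[k] LinearMap.mul' k A (TensorProduct.map f g t)) := by
  induction t with
  | zero => simp
  | add c d hc hd => simp only [TensorProduct.tmul_add, map_add, hc, hd]
  | tmul c d =>
    rw [TensorProduct.map_tmul, LinearMap.mul'_apply, hφ.2.1]
    induction W.δ x with
    | zero => simp
    | add a b ha hb => simp only [TensorProduct.add_tmul, map_add, ha, hb]
    | tmul a b => simp

theorem crossedG1_u2_iff (hW : IsWeakHopf W) (hφ : IsWeakModAlg W φ) :
    CrossedG1 W φ (u2 φ) ↔
      ∀ (g h : H) (b : A), φ ((g * h) ⊗ₜ[k] b) = φ (g ⊗ₜ[k] φ (h ⊗ₜ[k] b)) := by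
  refine forall_congr' fun x => forall_congr' fun y => forall_congr' fun b => ?_
  have left := LinearMap.congr_fun
    (conv_comp_mul' hW (u1 φ) (φ ∘ₗ (TensorProduct.mk k H A).flip b)) (x ⊗ₜ[k] y)
  rw [conv_u1_act hφ] at left
  have right := mul'_map_act_lTensor hφ (φ ∘ₗ (TensorProduct.mk k H A).flip b) (u1 φ) x (W.δ y)
  have inner := LinearMap.congr_fun (conv_act_u1 hφ b) y
  simp only [conv, convG, LinearMap.comp_apply] at inner
  rw [inner, ← u2_eq_comp_lTensor hφ] at right
  refine Eq.congr ?_ ?_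
  · simpa [conv, convG, u2] using left
  · simpa [δ2] using right

/-- The counit contracts the third leg in the right-hand side of the cocycle condition. -/
theorem mul'_map_counit_tensorTensorTensorComm (f : H →ₗ[k] A) (s t r : H ⊗[k] H) :
    LinearMap.mul' k A (TensorProduct.map
      ((TensorProduct.rid k A).toLinearMap ∘ₗ
        TensorProduct.map (f ∘ₗ LinearMap.mul' k H) W.ε ∘ₗ
        (TensorProduct.assoc k H H H).symm.toLinearMap)
      ((f ∘ₗ LinearMap.mul' k H) ∘ₗ LinearMap.rTensor H (LinearMap.mul' k H) ∘ₗ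
        (TensorProduct.assoc k H H H).symm.toLinearMap)
      (TensorProduct.tensorTensorTensorComm k H H (H ⊗[k] H) (H ⊗[k] H)
        (s ⊗ₜ[k] TensorProduct.tensorTensorTensorComm k H H H H (t ⊗ₜ[k] r)))) =
    LinearMap.mul' k A (TensorProduct.map f
      (f ∘ₗ LinearMap.mulRight k (TensorProduct.lid k H (LinearMap.rTensor H W.ε r)))
      (s * t)) := by
  induction s with
  | zero => simp
  | add a b ha hb => simp only [TensorProduct.add_tmul, map_add, ha, hb, add_mul]
  | tmul a b =>
    induction t with
    | zero => simp
    | add c d hc hd =>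
      simp only [TensorProduct.tmul_add, TensorProduct.add_tmul, map_add, hc, hd, mul_add]
    | tmul c d =>
      induction r with
      | zero => simp
      | add p q hp hq =>
        simp only [TensorProduct.tmul_add, map_add, hp, hq]
        simp [mul_add]
      | tmul p q => simp

theorem crossedG2_u2 (hW : IsWeakHopf W) (hφ : IsWeakModAlg W φ) : CrossedG2 W φ (u2 φ) := by
  refine TensorProduct.ext' fun x t => ?_
  induction t with
  | zero => simp
  | add a b ha hb => simp only [TensorProduct.tmul_add, map_add, ha, hb]
  | tmul y z => ?_
  have assoc_act : u2 φ ∘ₗ LinearMap.lTensor H (LinearMap.mul' k H) =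
      φ ∘ₗ LinearMap.lTensor H (u2 φ) := by
    refine TensorProduct.ext' fun a t => ?_
    simpa [u2] using u1_mul hφ a (LinearMap.mul' k H t)
  have right_act : u1 φ ∘ₗ LinearMap.mulRight k z =
      φ ∘ₗ (TensorProduct.mk k H A).flip (u1 φ z) :=
    LinearMap.ext fun a => by simpa using u1_mul hφ a z
  have left := mul'_map_act_lTensor hφ (u2 φ) (u2 φ) x (δ2 W (y ⊗ₜ[k] z))
  have inner := LinearMap.congr_fun (conv_u2_u2 hW hφ) (y ⊗ₜ[k] z)
  simp only [conv, convG, LinearMap.comp_apply] at inner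
  rw [inner] at left
  have right := mul'_map_counit_tensorTensorTensorComm (W := W) (u1 φ) (W.δ x) (W.δ y) (W.δ z)
  have outer := LinearMap.congr_fun (conv_u1_act hφ (u1 φ z)) (x * y)
  simp only [conv, convG, LinearMap.comp_apply] at outer
  rw [hW.counit_left, ← hW.a1, right_act, outer] at right
  rw [assoc_act]
  refine (left.trans ?_).trans right.symm
  simp [u2, ← u1_mul hφ, mul_assoc]

theorem crossedG3_u2 : CrossedG3 W φ (u2 φ) := fun h => by simp [u2]

end StrictAction

/-- Let `H` be a cocommutative weak Hopf algebra and `(A, φ)`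
a weak left `H`-module algebra.  Then `(A, φ)` is a left `H`-module algebra
iff `(φ, u₂)` is a crossed system for `H` over `A`, where `u₂ = u₁ ∘ μ_H` and
`u₁ = φ∘(H⊗η_A)`. -/
theorem statement9 {k H A : Type} [CommRing k] [Ring H] [Algebra k H]
    [Ring A] [Algebra k A]
    (W : HopfData k H) (hW : IsWeakHopf W) (hcc : Cocomm W)
    (φ : H ⊗[k] A →ₗ[k] A) (hφ : IsWeakModAlg W φ) :
    (∀ (g h : H) (b : A), φ ((g * h) ⊗ₜ[k] b) = φ (g ⊗ₜ[k] φ (h ⊗ₜ[k] b))) ↔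
    (∃ σinv : H ⊗[k] H →ₗ[k] A, IsCrossedSystem W φ (u2 φ) σinv) := by
  rw [← crossedG1_u2_iff hW hφ]
  refine ⟨fun h => ⟨u2 φ, hφ, ?_, h, crossedG2_u2 hW hφ, crossedG3_u2⟩, fun ⟨_, h⟩ => h.2.2.1⟩
  simp only [IsRegPair2, conv_u2_u2 hW hφ, and_self]

end WHA

end
end

section
/- Let H be a cocommutative weak Hopf algebra over a commutative ring k and (φ_A, σ) a crossed system for H over A. Then the weak crossed product algebra A×_σH is a right H-comodule algebra for the coaction ρ_{A×_σH} = (p_{A⊗H}⊗H)∘(A⊗δ_H)∘i_{A⊗H}. Moreover, the map i_{A×_σH} = p_{A⊗H}∘(A⊗η_H): A → A×_σH is an injective algebra morphism whose image is exactly the subalgebra of coinvariants (A×_σH)_H. -/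
open TensorProduct

noncomputable section

namespace WHA

variable (k : Type) [CommRing k]

variable (H : Type) [Ring H] [Algebra k H]

variable {k H}

section Convolution

open Coalgebra

variable {C D E R S : Type} [AddCommGroup C] [Module k C] [Coalgebra k C]
  [AddCommGroup D] [Module k D] [Coalgebra k D] [AddCommGroup E] [Module k E] [Coalgebra k E]
  [Ring R] [Algebra k R] [Ring S] [Algebra k S]

/-- The convolution product of linear maps from a coalgebra to an algebra. -/
notation:70 f:70 "⋄" g:71 => conv _ Coalgebra.comul f g

theorem comul_tmul_eq (c : C) (d : D) :
    comul (R := k) (c ⊗ₜ[k] d) =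
      TensorProduct.tensorTensorTensorComm k C C D D (comul c ⊗ₜ[k] comul d) := rfl

theorem conv_apply (f g : C →ₗ[k] R) (c : C) :
    (f ⋄ g) c = LinearMap.mul' k R (TensorProduct.map f g (comul c)) := rfl

theorem conv_assoc (f g h : C →ₗ[k] R) : f ⋄ g ⋄ h = f ⋄ (g ⋄ h) := by
  have key : ∀ v : C ⊗[k] C, LinearMap.mul' k R (TensorProduct.map (f ⋄ g) h v) =
      LinearMap.mul' k R (TensorProduct.map f (LinearMap.mul' k R ∘ₗ TensorProduct.map g h)
        (TensorProduct.assoc k C C C (comul.rTensor C v))) := by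
    intro v
    hopf_tensor_induction v with a b
    simp only [TensorProduct.map_tmul, LinearMap.rTensor_tmul, conv_apply,
      LinearMap.mul'_apply]
    hopf_tensor_induction comul (R := k) a with a₁ a₂
    simp [mul_assoc]
  have key' : ∀ v : C ⊗[k] C, LinearMap.mul' k R (TensorProduct.map f (g ⋄ h) v) =
      LinearMap.mul' k R (TensorProduct.map f (LinearMap.mul' k R ∘ₗ TensorProduct.map g h)
        (comul.lTensor C v)) := by
    intro v
    hopf_tensor_induction v with a b
    simp [conv_apply]
  ext c
  rw [conv_apply, conv_apply, key, key', coassoc_apply]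

theorem algHom_comp_conv (j : R →ₐ[k] S) (f g : C →ₗ[k] R) :
    j.toLinearMap ∘ₗ (f ⋄ g) = (j.toLinearMap ∘ₗ f) ⋄ (j.toLinearMap ∘ₗ g) := by
  ext c
  simp only [LinearMap.comp_apply, conv_apply]
  hopf_tensor_induction comul (R := k) c with a b
  simp

/-- The scalar multiple `c ↦ ε(c) r` of the counit. -/
def counitSMul (C : Type) [AddCommGroup C] [Module k C] [Coalgebra k C] (r : R) : C →ₗ[k] R :=
  LinearMap.toSpanSingleton k R r ∘ₗ counit

theorem counitSMul_apply (r : R) (c : C) : counitSMul (k := k) C r c = counit (R := k) c • r := rfl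

theorem counitSMul_conv_apply (r : R) (f : C →ₗ[k] R) (c : C) :
    (counitSMul C r ⋄ f) c = r * f c := by
  have key : ∀ v : C ⊗[k] C, LinearMap.mul' k R (TensorProduct.map (counitSMul C r) f v) =
      r * f (TensorProduct.lid k C (counit.rTensor C v)) := by
    intro v
    hopf_tensor_induction v with a b
    simp [counitSMul_apply]
  rw [conv_apply, key, rTensor_counit_comul]
  simp

theorem counitSMul_one_conv (f : C →ₗ[k] R) : counitSMul C 1 ⋄ f = f := by
  ext c
  rw [counitSMul_conv_apply, one_mul]

/-- A linear map between coalgebras which is compatible with the comultiplications, but possibly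
not with the counits. -/
def IsComul (q : C →ₗ[k] D) : Prop := ∀ c, comul (q c) = TensorProduct.map q q (comul (R := k) c)

theorem IsComul.id : IsComul (LinearMap.id : C →ₗ[k] C) := fun c => by simp

theorem IsComul.comp {r : D →ₗ[k] E} {q : C →ₗ[k] D} (hr : IsComul r) (hq : IsComul q) :
    IsComul (r ∘ₗ q) := fun c => by
  rw [LinearMap.comp_apply, hr, hq, TensorProduct.map_comp, LinearMap.comp_apply]

theorem IsComul.map {C' D' : Type} [AddCommGroup C'] [Module k C'] [Coalgebra k C']
    [AddCommGroup D'] [Module k D'] [Coalgebra k D'] {q : C →ₗ[k] C'} {r : D →ₗ[k] D'}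
    (hq : IsComul q) (hr : IsComul r) : IsComul (TensorProduct.map q r) := fun x => by
  hopf_tensor_induction x with c d
  rw [TensorProduct.map_tmul, comul_tmul_eq, comul_tmul_eq, hq, hr]
  hopf_tensor_induction comul (R := k) c with c₁ c₂
  hopf_tensor_induction comul (R := k) d with d₁ d₂
  simp

theorem IsComul.assoc : IsComul (TensorProduct.assoc k C D E).toLinearMap := fun x =>
  (LinearMap.congr_fun (Coalgebra.TensorProduct.assoc k k C D E).toCoalgHom.map_comp_comul x).symm

theorem IsComul.conv_comp {q : C →ₗ[k] D} (hq : IsComul q) (f g : D →ₗ[k] R) :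
    (f ⋄ g) ∘ₗ q = (f ∘ₗ q) ⋄ (g ∘ₗ q) := by
  ext c
  rw [LinearMap.comp_apply, conv_apply, conv_apply, hq, TensorProduct.map_comp,
    LinearMap.comp_apply]

/-- The projection `C ⊗ D → C` given by the counit of `D`. -/
def fstC (C D : Type) [AddCommGroup C] [Module k C] [AddCommGroup D] [Module k D]
    [Coalgebra k D] : C ⊗[k] D →ₗ[k] C :=
  (TensorProduct.rid k C).toLinearMap ∘ₗ LinearMap.lTensor C counit

theorem fstC_tmul {M : Type} [AddCommGroup M] [Module k M] (m : M) (d : D) :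
    fstC (k := k) M D (m ⊗ₜ d) = counit (R := k) d • m := by
  simp [fstC]

theorem map_counit_comul (c : C) (d : D) :
    TensorProduct.map (fstC C D) LinearMap.id (comul (c ⊗ₜ[k] d)) =
      LinearMap.lTensor C ((TensorProduct.mk k C D).flip d) (comul (R := k) c) := by
  rw [comul_tmul_eq]
  hopf_tensor_induction comul (R := k) c with c₁ c₂
  have key : ∀ v : D ⊗[k] D, TensorProduct.map (fstC C D) LinearMap.id
      (TensorProduct.tensorTensorTensorComm k C C D D ((c₁ ⊗ₜ[k] c₂) ⊗ₜ[k] v)) =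
      c₁ ⊗ₜ (c₂ ⊗ₜ[k] TensorProduct.lid k D (counit.rTensor D v)) := by
    intro v
    hopf_tensor_induction v with a b
    simp [fstC_tmul, TensorProduct.smul_tmul]
  rw [key, rTensor_counit_comul]
  simp

theorem IsComul.fstC : IsComul (fstC (k := k) C D) := fun x => by
  hopf_tensor_induction x with c d
  have h := congrArg (LinearMap.lTensor C (WHA.fstC C D)) (map_counit_comul (k := k) c d)
  rw [← LinearMap.comp_apply, LinearMap.lTensor_comp_map, LinearMap.comp_id] at h
  rw [h, fstC_tmul, map_smul]
  generalize comul (R := k) c = v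
  induction v with
  | zero => simp
  | tmul c₁ c₂ => simp [fstC_tmul]
  | add v w hv hw => rw [smul_add, hv, hw, map_add, map_add]

theorem fstC_conv_tmul (s : C →ₗ[k] R) (f : C ⊗[k] D →ₗ[k] R) (c : C) (d : D) :
    ((s ∘ₗ fstC C D) ⋄ f) (c ⊗ₜ d) =
      LinearMap.mul' k R (TensorProduct.map s (f ∘ₗ (TensorProduct.mk k C D).flip d)
        (comul c)) := by
  have h := congrArg (LinearMap.mul' k R ∘ₗ TensorProduct.map s f) (map_counit_comul (k := k) c d)
  rw [LinearMap.comp_apply, ← LinearMap.comp_apply (TensorProduct.map s f),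
    ← TensorProduct.map_comp, LinearMap.comp_id, LinearMap.comp_apply,
    ← LinearMap.comp_apply (TensorProduct.map s f), LinearMap.map_comp_lTensor] at h
  exact h

theorem counitSMul_comp_fstC (r : R) :
    counitSMul C r ∘ₗ fstC (k := k) C D = counitSMul (C ⊗[k] D) r := by
  ext c d
  simp [fstC_tmul, counitSMul_apply, mul_smul]

end Convolution

section Graph

open Coalgebra

variable {C D A : Type} [AddCommGroup C] [Module k C] [Coalgebra k C]
  [AddCommGroup D] [Module k D] [Coalgebra k D] [Ring A] [Algebra k A]

/-- The map `c ↦ s(c₁) ⊗ q(c₂)`. -/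
def graph (s : C →ₗ[k] A) (q : C →ₗ[k] H) : C →ₗ[k] A ⊗[k] H :=
  TensorProduct.map s q ∘ₗ comul

/-- The inclusion `a ↦ a ⊗ 1`. -/
abbrev inclA (k H A : Type) [CommRing k] [Ring H] [Algebra k H] [Ring A] [Algebra k A] :
    A →ₐ[k] A ⊗[k] H :=
  Algebra.TensorProduct.includeLeft

theorem graph_eq_conv (s : C →ₗ[k] A) (q : C →ₗ[k] H) :
    graph s q = ((inclA k H A).toLinearMap ∘ₗ s) ⋄
      ((Algebra.TensorProduct.includeRight : H →ₐ[k] A ⊗[k] H).toLinearMap ∘ₗ q) := by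
  ext c
  rw [conv_apply, graph, LinearMap.comp_apply]
  hopf_tensor_induction comul (R := k) c with a b
  simp

theorem conv_graph (f s : C →ₗ[k] A) (q : C →ₗ[k] H) :
    ((inclA k H A).toLinearMap ∘ₗ f) ⋄ graph s q = graph (f ⋄ s) q := by
  rw [graph_eq_conv, graph_eq_conv, algHom_comp_conv, conv_assoc]

theorem graph_comp {q : C →ₗ[k] D} (hq : IsComul q) (s : D →ₗ[k] A) (r : D →ₗ[k] H) :
    graph s r ∘ₗ q = graph (s ∘ₗ q) (r ∘ₗ q) := by
  ext c
  rw [LinearMap.comp_apply, graph, graph, LinearMap.comp_apply, LinearMap.comp_apply, hq,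
    TensorProduct.map_comp, LinearMap.comp_apply]

theorem graph_counitSMul (q : C →ₗ[k] H) (a : A) (c : C) :
    graph (counitSMul C a) q c = a ⊗ₜ q c := by
  have key : ∀ v : C ⊗[k] C, TensorProduct.map (counitSMul C a) q v =
      a ⊗ₜ q (TensorProduct.lid k C (counit.rTensor C v)) := by
    intro v
    hopf_tensor_induction v with c₁ c₂
    simp [counitSMul_apply, TensorProduct.smul_tmul]
  rw [graph, LinearMap.comp_apply, key, rTensor_counit_comul]
  simp

variable [Coalgebra k H]

theorem lTensor_comul_graph (s : C →ₗ[k] A) {q : C →ₗ[k] H} (hq : IsComul q) (c : C) :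
    (TensorProduct.assoc k A H H).symm (LinearMap.lTensor A comul (graph s q c)) =
      TensorProduct.map (graph s q) q (comul c) := by
  have key : ∀ v : C ⊗[k] C,
      LinearMap.lTensor A comul (TensorProduct.map s q v) =
        TensorProduct.map s (TensorProduct.map q q) (comul.lTensor C v) := by
    intro v
    hopf_tensor_induction v with c₁ c₂
    simp [hq c₂]
  have key' : ∀ v : C ⊗[k] C, TensorProduct.assoc k A H H (TensorProduct.map (graph s q) q v) =
      TensorProduct.map s (TensorProduct.map q q)
        (TensorProduct.assoc k C C C (comul.rTensor C v)) := by
    intro v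
    hopf_tensor_induction v with c₁ c₂
    simp only [graph, TensorProduct.map_tmul, LinearMap.comp_apply, LinearMap.rTensor_tmul]
    hopf_tensor_induction comul (R := k) c₁ with a b
    simp
  rw [LinearEquiv.symm_apply_eq, key', coassoc_apply, graph, LinearMap.comp_apply, key]

end Graph

section Ambient

open Coalgebra

variable {A : Type} [Ring A] [Algebra k A]
  {W : HopfData k H} {φ : H ⊗[k] A →ₗ[k] A} {σ : H ⊗[k] H →ₗ[k] A}

theorem crossmulAmb_tmul (a b : A) (x y : H) :
    crossmulAmb W φ σ ((a ⊗ₜ x) ⊗ₜ (b ⊗ₜ y)) =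
      inclA k H A a * LinearMap.mul' k (A ⊗[k] H) (TensorProduct.map
        ((inclA k H A).toLinearMap ∘ₗ φ ∘ₗ (TensorProduct.mk k H A).flip b)
        (σHA W σ ∘ₗ (TensorProduct.mk k H H).flip y) (W.δ x)) := by
  simp only [crossmulAmb, ψmap, LinearMap.comp_apply, LinearEquiv.coe_coe,
    TensorProduct.assoc_tmul, TensorProduct.assoc_symm_tmul, LinearMap.lTensor_tmul,
    LinearMap.rTensor_tmul]
  hopf_tensor_induction W.δ x with x₁ x₂
  simp only [TensorProduct.assoc_tmul, TensorProduct.assoc_symm_tmul, LinearMap.lTensor_tmul,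
    LinearMap.rTensor_tmul, LinearEquiv.coe_coe, TensorProduct.comm_tmul, TensorProduct.map_tmul,
    LinearMap.comp_apply, TensorProduct.mk_apply, LinearMap.flip_apply, LinearMap.mul'_apply]
  hopf_tensor_induction σHA W σ (x₂ ⊗ₜ y) with c h
  simp

theorem crossmulAmb_inclA_mul (a : A) (X Y : A ⊗[k] H) :
    crossmulAmb W φ σ ((inclA k H A a * X) ⊗ₜ Y) =
      inclA k H A a * crossmulAmb W φ σ (X ⊗ₜ Y) := by
  hopf_tensor_induction X with c x
  hopf_tensor_induction Y with b y
  rw [crossmulAmb_tmul, ← mul_assoc, ← map_mul, ← crossmulAmb_tmul]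
  simp

variable {C D : Type} [AddCommGroup C] [Module k C] [Coalgebra k C]
  [AddCommGroup D] [Module k D] [Coalgebra k D] [Coalgebra k H]

theorem σHA_eq_graph (hδ : W.δ = comul) : σHA W σ = graph σ (LinearMap.mul' k H) := by
  unfold σHA graph δ2
  rw [hδ]
  rfl

theorem crossmulAmb_graph (hδ : W.δ = comul) {q : C →ₗ[k] H} (hq : IsComul q) {r : D →ₗ[k] H}
    (hr : IsComul r) (s : C →ₗ[k] A) (t : D →ₗ[k] A) (c : C) (d : D) :
    crossmulAmb W φ σ (graph s q c ⊗ₜ graph t r d) =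
      graph ((s ∘ₗ fstC C D) ⋄ ((φ ∘ₗ TensorProduct.map q t) ⋄ (σ ∘ₗ TensorProduct.map q r)))
        (LinearMap.mul' k H ∘ₗ TensorProduct.map q r) (c ⊗ₜ d) := by
  have inner : ∀ c : C, crossmulAmb W φ σ ((1 ⊗ₜ q c) ⊗ₜ graph t r d) =
      (((inclA k H A).toLinearMap ∘ₗ φ ∘ₗ TensorProduct.map q t) ⋄
        (graph σ (LinearMap.mul' k H) ∘ₗ TensorProduct.map q r)) (c ⊗ₜ d) := by
    intro c
    rw [conv_apply, comul_tmul_eq, graph, LinearMap.comp_apply]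
    hopf_tensor_induction comul (R := k) d with d₁ d₂
    rw [TensorProduct.map_tmul, crossmulAmb_tmul, hδ, hq, σHA_eq_graph hδ, map_one, one_mul]
    hopf_tensor_induction comul (R := k) c with c₁ c₂
    simp
  rw [← conv_graph, ← LinearMap.comp_assoc, fstC_conv_tmul, ← conv_graph,
    ← graph_comp (hq.map hr)]
  rw [graph, LinearMap.comp_apply]
  hopf_tensor_induction comul (R := k) c with c₁ c₂
  have h : (s c₁ ⊗ₜ q c₂ : A ⊗[k] H) = inclA k H A (s c₁) * (1 ⊗ₜ q c₂) := by simp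
  rw [TensorProduct.map_tmul, h, crossmulAmb_inclA_mul, inner]
  rfl

end Ambient

section CrossedSystem

open Coalgebra

variable {C A : Type} [AddCommGroup C] [Module k C] [Coalgebra k C] [Ring A] [Algebra k A]
  {W : HopfData k H} {φ : H ⊗[k] A →ₗ[k] A} {σ σinv : H ⊗[k] H →ₗ[k] A}

theorem act_counitSMul_one : φ ∘ₗ LinearMap.lTensor H (counitSMul C 1) = u1 φ ∘ₗ fstC H C := by
  ext h c
  simp [fstC_tmul, counitSMul_apply, u1]

theorem act_u1 (hA : IsWeakModAlg W φ) : φ ∘ₗ LinearMap.lTensor H (u1 φ) = u2 φ := by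
  ext g h
  exact (hA.2.2.1 g h).symm

variable [Coalgebra k H]

theorem δ2_eq_comul (hδ : W.δ = comul) : δ2 W = comul := by
  unfold δ2
  rw [hδ]
  rfl

theorem δ3_eq_comul (hδ : W.δ = comul) : δ3 W = comul := by
  unfold δ3
  rw [δ2_eq_comul hδ, hδ]
  rfl

theorem isComul_mul (hδ : W.δ = comul) (hW : IsWeakHopf W) : IsComul (LinearMap.mul' k H) := by
  intro v
  hopf_tensor_induction v with x y
  rw [LinearMap.mul'_apply, ← hδ, hW.a1, comul_tmul_eq, ← hδ]
  hopf_tensor_induction W.δ x with x₁ x₂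
  hopf_tensor_induction W.δ y with y₁ y₂
  simp

theorem act_conv (hδ : W.δ = comul) (hA : IsWeakModAlg W φ) (f g : C →ₗ[k] A) :
    φ ∘ₗ LinearMap.lTensor H (f ⋄ g) =
      (φ ∘ₗ LinearMap.lTensor H f) ⋄ (φ ∘ₗ LinearMap.lTensor H g) := by
  ext h c
  simp only [TensorProduct.AlgebraTensorModule.curry_apply, TensorProduct.curry_apply,
    LinearMap.coe_restrictScalars, LinearMap.comp_apply, LinearMap.lTensor_tmul]
  rw [conv_apply, conv_apply, comul_tmul_eq]
  hopf_tensor_induction comul (R := k) c with c₁ c₂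
  rw [TensorProduct.map_tmul, LinearMap.mul'_apply, hA.2.1, hδ]
  hopf_tensor_induction comul (R := k) h with h₁ h₂
  simp

theorem u1_conv_act (hδ : W.δ = comul) (hA : IsWeakModAlg W φ) (f : C →ₗ[k] A) :
    (u1 φ ∘ₗ fstC H C) ⋄ (φ ∘ₗ LinearMap.lTensor H f) = φ ∘ₗ LinearMap.lTensor H f := by
  rw [← act_counitSMul_one, ← act_conv hδ hA, counitSMul_one_conv]

theorem u1_conv_u2 (hδ : W.δ = comul) (hA : IsWeakModAlg W φ) :
    (u1 φ ∘ₗ fstC H H) ⋄ u2 φ = u2 φ := by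
  rw [← act_u1 hA, u1_conv_act hδ hA]

theorem u2_conv_cocycle (hδ : W.δ = comul) (hσ : IsRegPair2 W φ σ σinv) : u2 φ ⋄ σ = σ := by
  rw [← δ2_eq_comul hδ, ← hσ.1]
  exact hσ.2.2.1

theorem nabla_tmul (hδ : W.δ = comul) (a : A) (x : H) :
    nabla W φ (a ⊗ₜ x) = inclA k H A a * graph (u1 φ) LinearMap.id x := by
  simp only [nabla, ψmap, LinearMap.comp_apply, LinearEquiv.coe_coe, graph, hδ,
    LinearMap.lTensor_tmul, LinearMap.rTensor_tmul, TensorProduct.mk_apply, LinearMap.flip_apply]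
  hopf_tensor_induction comul (R := k) x with x₁ x₂
  simp [u1]

theorem nabla_graph (hδ : W.δ = comul) (s : C →ₗ[k] A) {q : C →ₗ[k] H} (hq : IsComul q) (c : C) :
    nabla W φ (graph s q c) = graph (s ⋄ (u1 φ ∘ₗ q)) q c := by
  have h := graph_comp hq (u1 φ) (LinearMap.id : H →ₗ[k] H)
  rw [LinearMap.id_comp] at h
  rw [← conv_graph, ← h, conv_apply, graph, LinearMap.comp_apply]
  hopf_tensor_induction comul (R := k) c with c₁ c₂
  rw [TensorProduct.map_tmul, nabla_tmul hδ]
  rfl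

theorem nabla_tmul_eq_graph (hδ : W.δ = comul) (a : A) (x : H) :
    nabla W φ (a ⊗ₜ x) = graph (counitSMul H a ⋄ u1 φ) LinearMap.id x := by
  have h := nabla_graph (φ := φ) hδ (counitSMul H a) IsComul.id x
  rwa [graph_counitSMul] at h

theorem crossmulAmb_tmul_eq_graph (hδ : W.δ = comul) (a b : A) (x y : H) :
    crossmulAmb W φ σ ((a ⊗ₜ x) ⊗ₜ (b ⊗ₜ y)) =
      graph ((counitSMul H a ∘ₗ fstC H H) ⋄ ((φ ∘ₗ LinearMap.lTensor H (counitSMul H b)) ⋄ σ))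
        (LinearMap.mul' k H) (x ⊗ₜ y) := by
  have h := crossmulAmb_graph (φ := φ) (σ := σ) hδ IsComul.id IsComul.id
    (counitSMul H a) (counitSMul H b) x y
  rw [graph_counitSMul, graph_counitSMul] at h
  rwa [← LinearMap.lTensor_def, TensorProduct.map_id, LinearMap.comp_id, LinearMap.comp_id] at h

theorem crossmulAmb_nabla_left (hδ : W.δ = comul) (hA : IsWeakModAlg W φ) (X Y : A ⊗[k] H) :
    crossmulAmb W φ σ (nabla W φ X ⊗ₜ Y) = crossmulAmb W φ σ (X ⊗ₜ Y) := by
  hopf_tensor_induction X with a x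
  hopf_tensor_induction Y with b y
  have h := crossmulAmb_graph (φ := φ) (σ := σ) hδ IsComul.id IsComul.id
    (counitSMul H a ⋄ u1 φ) (counitSMul H b) x y
  rw [graph_counitSMul, ← nabla_tmul_eq_graph hδ, IsComul.fstC.conv_comp, conv_assoc,
    ← conv_assoc (u1 φ ∘ₗ _), ← LinearMap.lTensor_def, u1_conv_act hδ hA, TensorProduct.map_id,
    LinearMap.comp_id, LinearMap.comp_id] at h
  rw [crossmulAmb_tmul_eq_graph hδ]
  exact h

theorem crossmulAmb_nabla_right (hδ : W.δ = comul) (hA : IsWeakModAlg W φ)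
    (hσ : IsRegPair2 W φ σ σinv) (X Y : A ⊗[k] H) :
    crossmulAmb W φ σ (X ⊗ₜ nabla W φ Y) = crossmulAmb W φ σ (X ⊗ₜ Y) := by
  hopf_tensor_induction X with a x
  hopf_tensor_induction Y with b y
  have h := crossmulAmb_graph (φ := φ) (σ := σ) hδ IsComul.id IsComul.id
    (counitSMul H a) (counitSMul H b ⋄ u1 φ) x y
  rw [graph_counitSMul, ← nabla_tmul_eq_graph hδ, ← LinearMap.lTensor_def, act_conv hδ hA,
    act_u1 hA, TensorProduct.map_id, LinearMap.comp_id, conv_assoc,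
    u2_conv_cocycle hδ hσ] at h
  rw [crossmulAmb_tmul_eq_graph hδ]
  exact h

theorem cocycle_conv_act (hδ : W.δ = comul) (h₁ : CrossedG1 W φ σ) (c : A) :
    (σ ∘ₗ fstC (H ⊗[k] H) H) ⋄ (φ ∘ₗ TensorProduct.map (LinearMap.mul' k H) (counitSMul H c)) =
      (φ ∘ₗ LinearMap.lTensor H (φ ∘ₗ LinearMap.lTensor H (counitSMul H c))) ∘ₗ
          (TensorProduct.assoc k H H H).toLinearMap ⋄
        (σ ∘ₗ fstC (H ⊗[k] H) H) := by
  have e₁ : φ ∘ₗ TensorProduct.map (LinearMap.mul' k H) (counitSMul H c) =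
      ((φ ∘ₗ (TensorProduct.mk k H A).flip c) ∘ₗ LinearMap.mul' k H) ∘ₗ fstC (H ⊗[k] H) H := by
    ext x y z
    simp [counitSMul_apply, fstC_tmul]
  have e₂ : (φ ∘ₗ LinearMap.lTensor H (φ ∘ₗ LinearMap.lTensor H (counitSMul H c))) ∘ₗ
      (TensorProduct.assoc k H H H).toLinearMap =
      (φ ∘ₗ LinearMap.lTensor H (φ ∘ₗ (TensorProduct.mk k H A).flip c)) ∘ₗ
        fstC (H ⊗[k] H) H := by
    ext x y z
    simp [counitSMul_apply, fstC_tmul]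
  rw [e₁, e₂, ← IsComul.fstC.conv_comp, ← IsComul.fstC.conv_comp]
  congr 1
  rw [← δ2_eq_comul hδ]
  ext x y
  exact h₁ x y c

theorem cocycle_conv_cocycle (hδ : W.δ = comul) (hε : W.ε = counit) (h₂ : CrossedG2 W φ σ) :
    (φ ∘ₗ LinearMap.lTensor H σ) ∘ₗ (TensorProduct.assoc k H H H).toLinearMap ⋄
        ((σ ∘ₗ LinearMap.lTensor H (LinearMap.mul' k H)) ∘ₗ
          (TensorProduct.assoc k H H H).toLinearMap) =
      (σ ∘ₗ fstC (H ⊗[k] H) H) ⋄ (σ ∘ₗ LinearMap.rTensor H (LinearMap.mul' k H)) := by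
  have h₂' := congrArg (fun f => f ∘ₗ (TensorProduct.assoc k H H H).toLinearMap) h₂
  simp only [δ3_eq_comul hδ] at h₂'
  rw [IsComul.assoc.conv_comp, IsComul.assoc.conv_comp] at h₂'
  rw [h₂']
  congr 1
  · ext x y z
    simp [fstC_tmul, hε]
  · ext x y z
    simp

theorem crossmulAmb_assoc (hδ : W.δ = comul) (hε : W.ε = counit) (hW : IsWeakHopf W)
    (hcs : IsCrossedSystem W φ σ σinv) (X Y Z : A ⊗[k] H) :
    crossmulAmb W φ σ (crossmulAmb W φ σ (X ⊗ₜ Y) ⊗ₜ Z) =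
      crossmulAmb W φ σ (X ⊗ₜ crossmulAmb W φ σ (Y ⊗ₜ Z)) := by
  obtain ⟨hA, -, h₁, h₂, -⟩ := hcs
  hopf_tensor_induction X with a x
  hopf_tensor_induction Y with b y
  hopf_tensor_induction Z with c z
  have hμ := isComul_mul hδ hW
  have hl := crossmulAmb_graph (φ := φ) (σ := σ) hδ hμ IsComul.id
    ((counitSMul H a ∘ₗ fstC H H) ⋄ ((φ ∘ₗ LinearMap.lTensor H (counitSMul H b)) ⋄ σ))
    (counitSMul H c) (x ⊗ₜ y) z
  have hr := crossmulAmb_graph (φ := φ) (σ := σ) hδ IsComul.id hμ (counitSMul H a)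
    ((counitSMul H b ∘ₗ fstC H H) ⋄ ((φ ∘ₗ LinearMap.lTensor H (counitSMul H c)) ⋄ σ))
    x (y ⊗ₜ z)
  rw [← crossmulAmb_tmul_eq_graph hδ, graph_counitSMul] at hl hr
  simp only [LinearMap.id_apply] at hl hr
  rw [hl, hr, ← TensorProduct.assoc_tmul, ← LinearEquiv.coe_coe, ← LinearMap.comp_apply,
    graph_comp IsComul.assoc]
  congr 2
  · rw [← LinearMap.lTensor_def, ← LinearMap.lTensor_def, ← LinearMap.rTensor_def,
      act_conv hδ hA, act_conv hδ hA]
    simp only [IsComul.assoc.conv_comp, IsComul.fstC.conv_comp, conv_assoc]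
    rw [cocycle_conv_cocycle hδ hε h₂,
      ← conv_assoc (σ ∘ₗ fstC _ _), cocycle_conv_act hδ h₁, conv_assoc]
    congr 1
    · ext x y z
      simp [fstC_tmul, counitSMul_apply, mul_smul]
    · congr 1
      ext x y z
      simp [fstC_tmul, counitSMul_apply]
  · ext x y z
    simp [mul_assoc]

theorem lTensor_comul_nabla (hδ : W.δ = comul) (X : A ⊗[k] H) :
    (TensorProduct.assoc k A H H).symm (LinearMap.lTensor A W.δ (nabla W φ X)) =
      LinearMap.rTensor H (nabla W φ)
        ((TensorProduct.assoc k A H H).symm (LinearMap.lTensor A W.δ X)) := by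
  hopf_tensor_induction X with a x
  rw [hδ, nabla_tmul_eq_graph hδ, lTensor_comul_graph _ IsComul.id, LinearMap.lTensor_tmul]
  hopf_tensor_induction comul (R := k) x with x₁ x₂
  simp [nabla_tmul_eq_graph hδ]

theorem lTensor_comul_crossmulAmb (hδ : W.δ = comul) (hW : IsWeakHopf W) (X Y : A ⊗[k] H) :
    (TensorProduct.assoc k A H H).symm
        (LinearMap.lTensor A W.δ (crossmulAmb W φ σ (X ⊗ₜ Y))) =
      TensorProduct.map (crossmulAmb W φ σ) (LinearMap.mul' k H)
        (TensorProduct.tensorTensorTensorComm k (A ⊗[k] H) H (A ⊗[k] H) H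
          ((TensorProduct.assoc k A H H).symm (LinearMap.lTensor A W.δ X) ⊗ₜ
            (TensorProduct.assoc k A H H).symm (LinearMap.lTensor A W.δ Y))) := by
  hopf_tensor_induction X with a x
  hopf_tensor_induction Y with b y
  rw [hδ, crossmulAmb_tmul_eq_graph hδ, lTensor_comul_graph _ (isComul_mul hδ hW),
    comul_tmul_eq, LinearMap.lTensor_tmul, LinearMap.lTensor_tmul]
  hopf_tensor_induction comul (R := k) x with x₁ x₂
  hopf_tensor_induction comul (R := k) y with y₁ y₂
  simp [crossmulAmb_tmul_eq_graph hδ]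

end CrossedSystem

section TargetMap

variable {W : HopfData k H}

theorem PiL_eq (h : H) : PiL W h =
    TensorProduct.lid k H (LinearMap.rTensor H (W.ε ∘ₗ LinearMap.mulRight k h) (W.δ 1)) := by
  simp only [PiL, LinearMap.comp_apply, TensorProduct.mk_apply, LinearEquiv.coe_coe]
  hopf_tensor_induction W.δ 1 with x y
  simp

theorem PiL_one (hW : IsWeakHopf W) : PiL W 1 = 1 := by
  rw [PiL_eq, LinearMap.mulRight_one, LinearMap.comp_id, hW.counit_left]

theorem δ_one_mul (hW : IsWeakHopf W) (x : H) : W.δ 1 * W.δ x = W.δ x := by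
  rw [← hW.a1, one_mul]

theorem δ_mul_one (hW : IsWeakHopf W) (x : H) : W.δ x * W.δ 1 = W.δ x := by
  rw [← hW.a1, mul_one]

theorem δ_PiL_eq (hW : IsWeakHopf W) (h : H) : W.δ (PiL W h) =
    TensorProduct.lid k (H ⊗[k] H) (LinearMap.rTensor (H ⊗[k] H)
      (W.ε ∘ₗ LinearMap.mulRight k h)
        (TensorProduct.assoc k H H H (LinearMap.rTensor H W.δ (W.δ 1)))) := by
  rw [hW.coassoc, PiL_eq]
  hopf_tensor_induction W.δ 1 with x y
  simp

theorem δ_PiL_left (hW : IsWeakHopf W) (h : H) :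
    W.δ (PiL W h) = (PiL W h ⊗ₜ 1) * W.δ 1 := by
  rw [δ_PiL_eq hW, hW.a3, PiL_eq]
  generalize W.ε ∘ₗ LinearMap.mulRight k h = f
  have key : ∀ v w : H ⊗[k] H, TensorProduct.lid k (H ⊗[k] H) (LinearMap.rTensor (H ⊗[k] H) f
      ((TensorProduct.map LinearMap.id
        (Algebra.TensorProduct.includeLeft : H →ₐ[k] H ⊗[k] H).toLinearMap) v *
      (Algebra.TensorProduct.includeRight : (H ⊗[k] H) →ₐ[k] H ⊗[k] (H ⊗[k] H)).toLinearMap w)) =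
      (TensorProduct.lid k H (LinearMap.rTensor H f v) ⊗ₜ 1) * w := by
    intro v w
    hopf_tensor_induction v with x y
    hopf_tensor_induction w with a b
    simp [TensorProduct.smul_tmul']
  exact key _ _

theorem δ_PiL_right (hW : IsWeakHopf W) (h : H) :
    W.δ (PiL W h) = W.δ 1 * (PiL W h ⊗ₜ 1) := by
  rw [δ_PiL_eq hW, hW.a3', PiL_eq]
  generalize W.ε ∘ₗ LinearMap.mulRight k h = f
  have key : ∀ v w : H ⊗[k] H, TensorProduct.lid k (H ⊗[k] H) (LinearMap.rTensor (H ⊗[k] H) f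
      ((Algebra.TensorProduct.includeRight : (H ⊗[k] H) →ₐ[k] H ⊗[k] (H ⊗[k] H)).toLinearMap w *
      (TensorProduct.map LinearMap.id
        (Algebra.TensorProduct.includeLeft : H →ₐ[k] H ⊗[k] H).toLinearMap) v)) =
      w * (TensorProduct.lid k H (LinearMap.rTensor H f v) ⊗ₜ 1) := by
    intro v w
    hopf_tensor_induction v with x y
    hopf_tensor_induction w with a b
    simp [TensorProduct.smul_tmul']
  exact key _ _

theorem comm_mul (v w : H ⊗[k] H) : TensorProduct.comm k H H (v * w) =
    TensorProduct.comm k H H v * TensorProduct.comm k H H w :=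
  map_mul (Algebra.TensorProduct.comm k H H) v w

theorem δ_PiL_left' (hW : IsWeakHopf W) (hcc : Cocomm W) (h : H) :
    W.δ (PiL W h) = (1 ⊗ₜ PiL W h) * W.δ 1 := by
  rw [← hcc (PiL W h), δ_PiL_left hW, comm_mul, hcc, TensorProduct.comm_tmul]

theorem δ_PiL_right' (hW : IsWeakHopf W) (hcc : Cocomm W) (h : H) :
    W.δ (PiL W h) = W.δ 1 * (1 ⊗ₜ PiL W h) := by
  rw [← hcc (PiL W h), δ_PiL_right hW, comm_mul, hcc, TensorProduct.comm_tmul]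

theorem δ_PiL_mul (hW : IsWeakHopf W) (h x : H) :
    W.δ (PiL W h * x) = (PiL W h ⊗ₜ 1) * W.δ x := by
  rw [hW.a1, δ_PiL_left hW, mul_assoc, δ_one_mul hW]

theorem δ_mul_PiL (hW : IsWeakHopf W) (x h : H) :
    W.δ (x * PiL W h) = W.δ x * (PiL W h ⊗ₜ 1) := by
  rw [hW.a1, δ_PiL_right hW, ← mul_assoc, δ_mul_one hW]

theorem lTensor_PiL_δ (hW : IsWeakHopf W) (h : H) :
    LinearMap.lTensor H (PiL W) (W.δ h) = W.δ 1 * (h ⊗ₜ 1) := by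
  let R (w : H ⊗[k] H) : H ⊗[k] (H ⊗[k] H) →ₗ[k] H ⊗[k] H :=
    LinearMap.rTensor H ((TensorProduct.rid k H).toLinearMap ∘ₗ LinearMap.lTensor H W.ε ∘ₗ
      LinearMap.mulRight k w) ∘ₗ (TensorProduct.assoc k H H H).symm.toLinearMap
  have expand : ∀ v w : H ⊗[k] H, R w
      ((Algebra.TensorProduct.includeRight :
          (H ⊗[k] H) →ₐ[k] H ⊗[k] (H ⊗[k] H)).toLinearMap (W.δ 1) *
      (TensorProduct.map LinearMap.id
        (Algebra.TensorProduct.includeLeft : H →ₐ[k] H ⊗[k] H).toLinearMap) v) =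
      LinearMap.lTensor H (PiL W) (v * w) := by
    intro v w
    have hR : ∀ w₁ w₂, R (w₁ + w₂) = R w₁ + R w₂ := by
      intro w₁ w₂
      ext
      simp [R, mul_add, TensorProduct.add_tmul]
    have hR0 : R 0 = 0 := by
      ext
      simp [R]
    induction w with
    | zero => simp [hR0]
    | add w₁ w₂ h₁ h₂ => rw [hR, LinearMap.add_apply, h₁, h₂, mul_add, map_add]
    | tmul a b =>
      hopf_tensor_induction v with x y
      rw [Algebra.TensorProduct.tmul_mul_tmul, LinearMap.lTensor_tmul, PiL_eq]
      hopf_tensor_induction W.δ 1 with c d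
      simp [R, TensorProduct.smul_tmul, mul_assoc]
  have collapse : ∀ v : H ⊗[k] H, R (W.δ h)
      (TensorProduct.assoc k H H H (LinearMap.rTensor H W.δ v)) = v * (h ⊗ₜ 1) := by
    intro v
    hopf_tensor_induction v with x y
    simp [R, ← hW.a1, hW.counit_right]
  rw [← collapse, hW.a3', expand, δ_one_mul hW]

theorem lTensor_PiL_δ_one (hW : IsWeakHopf W) :
    LinearMap.lTensor H (PiL W) (W.δ 1) = W.δ 1 := by
  rw [lTensor_PiL_δ hW, ← Algebra.TensorProduct.one_def, mul_one]

theorem rTensor_PiL_δ_one (hW : IsWeakHopf W) (hcc : Cocomm W) :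
    LinearMap.rTensor H (PiL W) (W.δ 1) = W.δ 1 := by
  have h := congrArg (TensorProduct.comm k H H) (lTensor_PiL_δ_one hW)
  rwa [LinearMap.lTensor_def, ← TensorProduct.map_comm, hcc] at h

theorem PiL_PiL_mul (hW : IsWeakHopf W) (hcc : Cocomm W) (g h : H) :
    PiL W (PiL W g * h) = PiL W g * PiL W h := by
  have h₁ : ∀ v : H ⊗[k] H, LinearMap.rTensor H (W.ε ∘ₗ LinearMap.mulRight k (PiL W g * h)) v =
      LinearMap.rTensor H (W.ε ∘ₗ LinearMap.mulRight k h) (v * (PiL W g ⊗ₜ 1)) := by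
    intro v
    hopf_tensor_induction v with x y
    simp [mul_assoc]
  have h₂ : ∀ (e : H) (v : H ⊗[k] H), TensorProduct.lid k H
      (LinearMap.rTensor H (W.ε ∘ₗ LinearMap.mulRight k h) ((1 ⊗ₜ e) * v)) =
      e * TensorProduct.lid k H (LinearMap.rTensor H (W.ε ∘ₗ LinearMap.mulRight k h) v) := by
    intro e v
    hopf_tensor_induction v with x y
    simp
  rw [PiL_eq (PiL W g * h), h₁, ← δ_PiL_right hW, δ_PiL_left' hW hcc, h₂, ← PiL_eq]

theorem δ_PiL (hW : IsWeakHopf W) (hcc : Cocomm W) (h : H) :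
    W.δ (PiL W h) = TensorProduct.map (PiL W) (PiL W) (W.δ h) := by
  have key : ∀ v : H ⊗[k] H, LinearMap.rTensor H (PiL W)
      (LinearMap.rTensor H (PiL W) v * (h ⊗ₜ 1)) =
      LinearMap.rTensor H (PiL W) v * (PiL W h ⊗ₜ 1) := by
    intro v
    hopf_tensor_induction v with x y
    simp [PiL_PiL_mul hW hcc]
  rw [← LinearMap.rTensor_comp_lTensor, LinearMap.comp_apply, lTensor_PiL_δ hW,
    ← rTensor_PiL_δ_one hW hcc, key, rTensor_PiL_δ_one hW hcc, δ_PiL_right hW]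

end TargetMap

section Unit

open Coalgebra

variable {A : Type} [Ring A] [Algebra k A]
  {W : HopfData k H} {φ : H ⊗[k] A →ₗ[k] A} {σ σinv : H ⊗[k] H →ₗ[k] A}

theorem u1_PiL (hA : IsWeakModAlg W φ) (h : H) : u1 φ (PiL W h) = u1 φ h := by
  have := hA.2.2.2 h 1
  rwa [mul_one] at this

theorem u1_PiL_mul (hA : IsWeakModAlg W φ) (g h : H) :
    u1 φ (PiL W g * h) = u1 φ g * u1 φ h :=
  (hA.2.2.1 _ _).trans (hA.2.2.2 g _)

theorem u1_mul_comm (hW : IsWeakHopf W) (hcc : Cocomm W) (hA : IsWeakModAlg W φ) (h : H) (b : A) :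
    u1 φ h * b = b * u1 φ h := by
  have key : ∀ v : H ⊗[k] H,
      LinearMap.mul' k A (TensorProduct.map (φ ∘ₗ (TensorProduct.mk k H A).flip b)
        (φ ∘ₗ (TensorProduct.mk k H A).flip 1) (v * (1 ⊗ₜ PiL W h))) =
      LinearMap.mul' k A (TensorProduct.map (φ ∘ₗ (TensorProduct.mk k H A).flip b)
        (φ ∘ₗ (TensorProduct.mk k H A).flip (u1 φ h)) v) := by
    intro v
    hopf_tensor_induction v with x y
    have := hA.2.2.1 y (PiL W h)
    rw [hA.2.2.2, mul_one] at this
    simp [this, u1]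
  calc u1 φ h * b = φ (PiL W h ⊗ₜ (b * 1)) := by rw [mul_one, hA.2.2.2]; rfl
    _ = φ (1 ⊗ₜ (b * u1 φ h)) := by
      rw [hA.2.1, δ_PiL_right' hW hcc, key, ← hA.2.1]
    _ = b * u1 φ h := hA.1 _

variable [Coalgebra k H]

theorem cocycle_PiL_mul (hδ : W.δ = comul) (hW : IsWeakHopf W) (hA : IsWeakModAlg W φ)
    (hσ : IsRegPair2 W φ σ σinv) (h x y : H) :
    σ ((PiL W h * x) ⊗ₜ y) = u1 φ h * σ (x ⊗ₜ y) := by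
  rw [← u2_conv_cocycle hδ hσ, conv_apply, conv_apply, comul_tmul_eq, comul_tmul_eq, ← hδ,
    δ_PiL_mul hW]
  hopf_tensor_induction W.δ x with x₁ x₂
  hopf_tensor_induction W.δ y with y₁ y₂
  simp [u2, mul_assoc, u1_PiL_mul hA]

theorem cocycle_mul_PiL (hδ : W.δ = comul) (hW : IsWeakHopf W)
    (hσ : IsRegPair2 W φ σ σinv) (h x y : H) :
    σ ((x * PiL W h) ⊗ₜ y) = σ (x ⊗ₜ (PiL W h * y)) := by
  rw [← u2_conv_cocycle hδ hσ, conv_apply, conv_apply, comul_tmul_eq, comul_tmul_eq, ← hδ,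
    δ_PiL_mul hW, δ_mul_PiL hW]
  hopf_tensor_induction W.δ x with x₁ x₂
  hopf_tensor_induction W.δ y with y₁ y₂
  simp [u2, mul_assoc]

theorem cocycle_comp_rTensor_PiL (hδ : W.δ = comul) (hW : IsWeakHopf W)
    (hA : IsWeakModAlg W φ) (hσ : IsRegPair2 W φ σ σinv) (h₃ : CrossedG3 W φ σ) :
    σ ∘ₗ LinearMap.rTensor H (PiL W) = u2 φ ∘ₗ LinearMap.rTensor H (PiL W) := by
  ext h y
  have := cocycle_PiL_mul hδ hW hA hσ h 1 y
  rw [mul_one, (h₃ y).2, ← u1_PiL_mul hA] at this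
  exact this

theorem cocycle_comp_lTensor_PiL (hδ : W.δ = comul) (hW : IsWeakHopf W)
    (hσ : IsRegPair2 W φ σ σinv) (h₃ : CrossedG3 W φ σ) :
    σ ∘ₗ LinearMap.lTensor H (PiL W) = u2 φ ∘ₗ LinearMap.lTensor H (PiL W) := by
  ext x h
  have := cocycle_mul_PiL hδ hW hσ h x 1
  rw [mul_one, (h₃ _).1] at this
  exact this.symm

theorem crossmulAmb_one_PiL_left (hδ : W.δ = comul) (hW : IsWeakHopf W) (hcc : Cocomm W)
    (hA : IsWeakModAlg W φ) (hσ : IsRegPair2 W φ σ σinv) (h₃ : CrossedG3 W φ σ)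
    (h y : H) (b : A) :
    crossmulAmb W φ σ ((1 ⊗ₜ PiL W h) ⊗ₜ (b ⊗ₜ y)) = nabla W φ (b ⊗ₜ (PiL W h * y)) := by
  have hPi : IsComul (PiL W) := fun c => by rw [← hδ, δ_PiL hW hcc]
  have hq : IsComul (LinearMap.mul' k H ∘ₗ LinearMap.rTensor H (PiL W)) :=
    (isComul_mul hδ hW).comp (hPi.map IsComul.id)
  have hact : φ ∘ₗ TensorProduct.map (PiL W) (counitSMul H b) =
      counitSMul _ b ⋄ (u1 φ ∘ₗ fstC H H) ∘ₗ LinearMap.rTensor H (PiL W) := by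
    ext g z
    simp only [TensorProduct.AlgebraTensorModule.curry_apply, TensorProduct.curry_apply,
      LinearMap.coe_restrictScalars, counitSMul_conv_apply]
    simp [fstC_tmul, counitSMul_apply, hA.2.2.2, u1_PiL hA, ← u1_mul_comm hW hcc hA]
    rfl
  have key := crossmulAmb_graph (φ := φ) (σ := σ) hδ hPi IsComul.id
    (counitSMul H 1) (counitSMul H b) h y
  rw [graph_counitSMul, graph_counitSMul, LinearMap.id_apply, ← LinearMap.rTensor_def,
    counitSMul_comp_fstC, counitSMul_one_conv, cocycle_comp_rTensor_PiL hδ hW hA hσ h₃, hact,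
    conv_assoc, LinearMap.rTensor_def, ← (hPi.map IsComul.id).conv_comp,
    u1_conv_u2 hδ hA, ← LinearMap.rTensor_def] at key
  rw [key]
  exact (nabla_graph hδ _ hq _).symm.trans (by rw [graph_counitSMul]; rfl)

theorem crossmulAmb_one_PiL_right (hδ : W.δ = comul) (hW : IsWeakHopf W) (hcc : Cocomm W)
    (hA : IsWeakModAlg W φ) (hσ : IsRegPair2 W φ σ σinv) (h₃ : CrossedG3 W φ σ)
    (h x : H) (a : A) :
    crossmulAmb W φ σ ((a ⊗ₜ x) ⊗ₜ (1 ⊗ₜ PiL W h)) = nabla W φ (a ⊗ₜ (x * PiL W h)) := by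
  have hPi : IsComul (PiL W) := fun c => by rw [← hδ, δ_PiL hW hcc]
  have hq : IsComul (LinearMap.mul' k H ∘ₗ LinearMap.lTensor H (PiL W)) :=
    (isComul_mul hδ hW).comp (IsComul.id.map hPi)
  have hu : u1 φ ∘ₗ PiL W = u1 φ := LinearMap.ext (u1_PiL hA)
  have hact : u2 φ ∘ₗ LinearMap.lTensor H (PiL W) = φ ∘ₗ LinearMap.lTensor H (u1 φ) := by
    rw [← act_u1 hA, LinearMap.comp_assoc, ← LinearMap.lTensor_comp, hu]
  have key := crossmulAmb_graph (φ := φ) (σ := σ) hδ IsComul.id hPi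
    (counitSMul H a) (counitSMul H 1) x h
  rw [graph_counitSMul, graph_counitSMul, LinearMap.id_apply, ← LinearMap.lTensor_def,
    ← LinearMap.lTensor_def, counitSMul_comp_fstC, cocycle_comp_lTensor_PiL hδ hW hσ h₃, hact,
    act_counitSMul_one, u1_conv_act hδ hA, ← hact] at key
  rw [key]
  exact (nabla_graph hδ _ hq _).symm.trans (by rw [graph_counitSMul]; rfl)

end Unit

section CrossedProduct

open Coalgebra

variable {A P : Type} [Ring A] [Algebra k A] [AddCommGroup P] [Module k P]
  {W : HopfData k H} {φ : H ⊗[k] A →ₗ[k] A} {σ σinv : H ⊗[k] H →ₗ[k] A}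
  {p : A ⊗[k] H →ₗ[k] P} {ι : P →ₗ[k] A ⊗[k] H}

/-- The coalgebra structure underlying a weak Hopf algebra. -/
abbrev IsWeakHopf.toCoalgebra (hW : IsWeakHopf W) : Coalgebra k H where
  comul := W.δ
  counit := W.ε
  coassoc := LinearMap.ext hW.coassoc
  rTensor_counit_comp_comul := LinearMap.ext fun h =>
    (TensorProduct.lid k H).injective (by simpa using hW.counit_left h)
  lTensor_counit_comp_comul := LinearMap.ext fun h =>
    (TensorProduct.rid k H).injective (by simpa using hW.counit_right h)

/-- The map `a ⊗ h ↦ a u₁(h)`. -/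
def mulU1 (φ : H ⊗[k] A →ₗ[k] A) : A ⊗[k] H →ₗ[k] A :=
  LinearMap.mul' k A ∘ₗ LinearMap.lTensor A (u1 φ)

theorem mulU1_tmul (a : A) (h : H) : mulU1 φ (a ⊗ₜ h) = a * u1 φ h := rfl

theorem proj_nabla (hsplit : ι ∘ₗ p = nabla W φ) (hretr : p ∘ₗ ι = LinearMap.id)
    (X : A ⊗[k] H) : p (nabla W φ X) = p X := by
  rw [← hsplit]
  exact LinearMap.congr_fun hretr (p X)

theorem crossCoact_tmul (p : A ⊗[k] H →ₗ[k] P) (a : A) (h : H) :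
    LinearMap.rTensor H p
        ((TensorProduct.assoc k A H H).symm (LinearMap.lTensor A W.δ (a ⊗ₜ h))) =
      LinearMap.rTensor H (p ∘ₗ TensorProduct.mk k A H a) (W.δ h) := by
  rw [LinearMap.lTensor_tmul]
  hopf_tensor_induction W.δ h with x y
  simp

variable [Coalgebra k H]

theorem nabla_eq_rTensor_mulU1 (hδ : W.δ = comul) (X : A ⊗[k] H) :
    nabla W φ X = LinearMap.rTensor H (mulU1 φ)
      ((TensorProduct.assoc k A H H).symm (LinearMap.lTensor A W.δ X)) := by
  hopf_tensor_induction X with a x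
  rw [nabla_tmul hδ, LinearMap.lTensor_tmul, graph, LinearMap.comp_apply, hδ]
  hopf_tensor_induction comul (R := k) x with x₁ x₂
  simp [mulU1_tmul]

theorem counit_nabla (hδ : W.δ = comul) (hW : IsWeakHopf W) (X : A ⊗[k] H) :
    TensorProduct.rid k A (LinearMap.lTensor A W.ε (nabla W φ X)) = mulU1 φ X := by
  have key : ∀ (a : A) (v : H ⊗[k] H),
      TensorProduct.rid k A (LinearMap.lTensor A W.ε (LinearMap.rTensor H (mulU1 φ)
        ((TensorProduct.assoc k A H H).symm (a ⊗ₜ v)))) =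
      a * u1 φ (TensorProduct.rid k H (LinearMap.lTensor H W.ε v)) := by
    intro a v
    hopf_tensor_induction v with x y
    simp [mulU1_tmul]
  hopf_tensor_induction X with a x
  rw [nabla_eq_rTensor_mulU1 hδ, LinearMap.lTensor_tmul, key, hW.counit_right, mulU1_tmul]

theorem crossMul_proj (hδ : W.δ = comul) (hA : IsWeakModAlg W φ) (hσ : IsRegPair2 W φ σ σinv)
    (hsplit : ι ∘ₗ p = nabla W φ) (X Y : A ⊗[k] H) :
    crossMul W φ σ p ι (p X ⊗ₜ p Y) = p (crossmulAmb W φ σ (X ⊗ₜ Y)) := by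
  have hX : ∀ X, ι (p X) = nabla W φ X := LinearMap.congr_fun hsplit
  rw [crossMul, LinearMap.comp_apply, LinearMap.comp_apply, TensorProduct.map_tmul, hX, hX,
    crossmulAmb_nabla_left hδ hA, crossmulAmb_nabla_right hδ hA hσ]

theorem crossCoact_proj (hδ : W.δ = comul) (hsplit : ι ∘ₗ p = nabla W φ)
    (hretr : p ∘ₗ ι = LinearMap.id) (X : A ⊗[k] H) :
    crossCoact W p ι (p X) = LinearMap.rTensor H p
      ((TensorProduct.assoc k A H H).symm (LinearMap.lTensor A W.δ X)) := by
  have hX : ι (p X) = nabla W φ X := LinearMap.congr_fun hsplit X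
  have hp : p ∘ₗ nabla W φ = p := LinearMap.ext (proj_nabla hsplit hretr)
  simp only [crossCoact, LinearMap.comp_apply, LinearEquiv.coe_coe]
  rw [hX, lTensor_comul_nabla hδ, ← LinearMap.comp_apply, ← LinearMap.rTensor_comp, hp]

theorem crossmulAmb_one_left (hδ : W.δ = comul) (hW : IsWeakHopf W) (hcc : Cocomm W)
    (hA : IsWeakModAlg W φ) (hσ : IsRegPair2 W φ σ σinv) (h₃ : CrossedG3 W φ σ)
    (X : A ⊗[k] H) : crossmulAmb W φ σ ((1 ⊗ₜ 1) ⊗ₜ X) = nabla W φ X := by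
  hopf_tensor_induction X with a x
  have h := crossmulAmb_one_PiL_left hδ hW hcc hA hσ h₃ 1 x a
  rwa [PiL_one hW, one_mul] at h

theorem crossmulAmb_one_right (hδ : W.δ = comul) (hW : IsWeakHopf W) (hcc : Cocomm W)
    (hA : IsWeakModAlg W φ) (hσ : IsRegPair2 W φ σ σinv) (h₃ : CrossedG3 W φ σ)
    (X : A ⊗[k] H) : crossmulAmb W φ σ (X ⊗ₜ (1 ⊗ₜ 1)) = nabla W φ X := by
  hopf_tensor_induction X with a x
  have h := crossmulAmb_one_PiL_right hδ hW hcc hA hσ h₃ 1 x a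
  rwa [PiL_one hW, mul_one] at h

theorem crossCoact_coassoc (hδ : W.δ = comul) (hW : IsWeakHopf W)
    (hsplit : ι ∘ₗ p = nabla W φ) (hretr : p ∘ₗ ι = LinearMap.id) (X : A ⊗[k] H) :
    TensorProduct.assoc k P H H
        (LinearMap.rTensor H (crossCoact W p ι) (crossCoact W p ι (p X))) =
      LinearMap.lTensor P W.δ (crossCoact W p ι (p X)) := by
  have left : ∀ (a : A) (v : H ⊗[k] H), TensorProduct.assoc k P H H
      (LinearMap.rTensor H (crossCoact W p ι)
        (LinearMap.rTensor H (p ∘ₗ TensorProduct.mk k A H a) v)) =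
      LinearMap.rTensor (H ⊗[k] H) (p ∘ₗ TensorProduct.mk k A H a)
        (TensorProduct.assoc k H H H (LinearMap.rTensor H W.δ v)) := by
    intro a v
    hopf_tensor_induction v with x y
    simp only [LinearMap.rTensor_tmul, LinearMap.comp_apply, TensorProduct.mk_apply]
    rw [crossCoact_proj hδ hsplit hretr, crossCoact_tmul]
    hopf_tensor_induction W.δ x with x₁ x₂
    simp
  have right : ∀ (a : A) (v : H ⊗[k] H), LinearMap.lTensor P W.δ
      (LinearMap.rTensor H (p ∘ₗ TensorProduct.mk k A H a) v) =
      LinearMap.rTensor (H ⊗[k] H) (p ∘ₗ TensorProduct.mk k A H a)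
        (LinearMap.lTensor H W.δ v) := by
    intro a v
    hopf_tensor_induction v with x y
    simp
  hopf_tensor_induction X with a x
  rw [crossCoact_proj hδ hsplit hretr, crossCoact_tmul, left, right, hW.coassoc]

theorem crossCoact_counit (hδ : W.δ = comul) (hW : IsWeakHopf W)
    (hsplit : ι ∘ₗ p = nabla W φ) (hretr : p ∘ₗ ι = LinearMap.id) (X : A ⊗[k] H) :
    TensorProduct.rid k P (LinearMap.lTensor P W.ε (crossCoact W p ι (p X))) = p X := by
  have key : ∀ (a : A) (v : H ⊗[k] H), TensorProduct.rid k P (LinearMap.lTensor P W.ε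
      (LinearMap.rTensor H (p ∘ₗ TensorProduct.mk k A H a) v)) =
      p (a ⊗ₜ TensorProduct.rid k H (LinearMap.lTensor H W.ε v)) := by
    intro a v
    hopf_tensor_induction v with x y
    simp
  hopf_tensor_induction X with a x
  rw [crossCoact_proj hδ hsplit hretr, crossCoact_tmul, key, hW.counit_right]

theorem crossCoact_mul (hδ : W.δ = comul) (hW : IsWeakHopf W) (hA : IsWeakModAlg W φ)
    (hσ : IsRegPair2 W φ σ σinv) (hsplit : ι ∘ₗ p = nabla W φ) (hretr : p ∘ₗ ι = LinearMap.id)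
    (X Y : A ⊗[k] H) :
    crossCoact W p ι (crossMul W φ σ p ι (p X ⊗ₜ p Y)) =
      TensorProduct.map (crossMul W φ σ p ι) (LinearMap.mul' k H)
        (TensorProduct.tensorTensorTensorComm k P H P H
          (crossCoact W p ι (p X) ⊗ₜ crossCoact W p ι (p Y))) := by
  have key : ∀ v w : (A ⊗[k] H) ⊗[k] H,
      TensorProduct.map (crossMul W φ σ p ι) (LinearMap.mul' k H)
        (TensorProduct.tensorTensorTensorComm k P H P H
          (LinearMap.rTensor H p v ⊗ₜ LinearMap.rTensor H p w)) =
      LinearMap.rTensor H p (TensorProduct.map (crossmulAmb W φ σ) (LinearMap.mul' k H)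
        (TensorProduct.tensorTensorTensorComm k (A ⊗[k] H) H (A ⊗[k] H) H (v ⊗ₜ w))) := by
    intro v w
    hopf_tensor_induction v with V x
    hopf_tensor_induction w with Z y
    simp [crossMul_proj hδ hA hσ hsplit]
  rw [crossMul_proj hδ hA hσ hsplit, crossCoact_proj hδ hsplit hretr,
    crossCoact_proj hδ hsplit hretr, crossCoact_proj hδ hsplit hretr, key,
    lTensor_comul_crossmulAmb hδ hW]

theorem lTensor_PiL_crossCoact_one (hδ : W.δ = comul) (hW : IsWeakHopf W)
    (hsplit : ι ∘ₗ p = nabla W φ) (hretr : p ∘ₗ ι = LinearMap.id) :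
    LinearMap.lTensor P (PiL W) (crossCoact W p ι (p (1 ⊗ₜ 1))) =
      crossCoact W p ι (p (1 ⊗ₜ 1)) := by
  rw [crossCoact_proj hδ hsplit hretr, crossCoact_tmul, ← LinearMap.comp_apply,
    LinearMap.lTensor_comp_rTensor, ← LinearMap.rTensor_comp_lTensor, LinearMap.comp_apply,
    lTensor_PiL_δ_one hW]

theorem zetaGen_proj_tmul (hδ : W.δ = comul) (hW : IsWeakHopf W) (hcc : Cocomm W)
    (hA : IsWeakModAlg W φ) (hσ : IsRegPair2 W φ σ σinv) (h₃ : CrossedG3 W φ σ)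
    (hsplit : ι ∘ₗ p = nabla W φ) (hretr : p ∘ₗ ι = LinearMap.id) (a : A) (h : H) :
    zetaGen (crossMul W φ σ p ι) (crossCoact W p ι (p (1 ⊗ₜ 1))) (p (a ⊗ₜ h)) =
      LinearMap.rTensor H (p ∘ₗ TensorProduct.mk k A H a ∘ₗ LinearMap.mulRight k h)
        (W.δ 1) := by
  have key : ∀ v : H ⊗[k] H, zetaGen (crossMul W φ σ p ι)
      (LinearMap.rTensor H (p ∘ₗ TensorProduct.mk k A H 1) (LinearMap.rTensor H (PiL W) v))
        (p (a ⊗ₜ h)) =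
      LinearMap.rTensor H (p ∘ₗ TensorProduct.mk k A H a ∘ₗ LinearMap.mulRight k h)
        (LinearMap.rTensor H (PiL W) v) := by
    intro v
    unfold zetaGen
    hopf_tensor_induction v with x y
    simp [crossMul_proj hδ hA hσ hsplit, crossmulAmb_one_PiL_left hδ hW hcc hA hσ h₃,
      proj_nabla hsplit hretr]
  rw [crossCoact_proj hδ hsplit hretr, crossCoact_tmul, ← rTensor_PiL_δ_one hW hcc, key]

theorem nabla_mulU1_tmul_one (hδ : W.δ = comul) (hW : IsWeakHopf W) (hcc : Cocomm W)
    (hA : IsWeakModAlg W φ) (a : A) (h : H) :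
    LinearMap.rTensor H (mulU1 φ ∘ₗ TensorProduct.mk k A H a ∘ₗ LinearMap.mulRight k h)
        (W.δ 1) = nabla W φ (mulU1 φ (a ⊗ₜ h) ⊗ₜ 1) := by
  have key : ∀ v : H ⊗[k] H,
      LinearMap.rTensor H (mulU1 φ ∘ₗ TensorProduct.mk k A H a ∘ₗ LinearMap.mulRight k h)
        (LinearMap.rTensor H (PiL W) v) =
      LinearMap.rTensor H (mulU1 φ ∘ₗ TensorProduct.mk k A H (a * u1 φ h)) v := by
    intro v
    hopf_tensor_induction v with x y
    simp [mulU1_tmul, u1_PiL_mul hA, u1_mul_comm hW hcc hA x, mul_assoc]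
  rw [nabla_eq_rTensor_mulU1 hδ, crossCoact_tmul, ← rTensor_PiL_δ_one hW hcc, key,
    rTensor_PiL_δ_one hW hcc, mulU1_tmul]

/-- A coinvariant element `p X` of the crossed product comes from `A`. -/
theorem eq_crossInc_of_coinv (hδ : W.δ = comul) (hW : IsWeakHopf W) (hcc : Cocomm W)
    (hA : IsWeakModAlg W φ) (hσ : IsRegPair2 W φ σ σinv) (h₃ : CrossedG3 W φ σ)
    (hsplit : ι ∘ₗ p = nabla W φ) (hretr : p ∘ₗ ι = LinearMap.id) (X : A ⊗[k] H)
    (hX : crossCoact W p ι (p X) =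
      zetaGen (crossMul W φ σ p ι) (crossCoact W p ι (p (1 ⊗ₜ 1))) (p X)) :
    crossInc p (mulU1 φ X) = p X := by
  let Θ : P →ₗ[k] A := (TensorProduct.rid k A).toLinearMap ∘ₗ LinearMap.lTensor A W.ε ∘ₗ ι
  have hΘ : Θ ∘ₗ p = mulU1 φ := LinearMap.ext fun Y =>
    (congrArg (fun Z => TensorProduct.rid k A (LinearMap.lTensor A W.ε Z))
      (LinearMap.congr_fun hsplit Y)).trans (counit_nabla hδ hW Y)
  have hζ : ∀ Y : A ⊗[k] H, LinearMap.rTensor H Θ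
      (zetaGen (crossMul W φ σ p ι) (crossCoact W p ι (p (1 ⊗ₜ 1))) (p Y)) =
      nabla W φ (mulU1 φ Y ⊗ₜ 1) := by
    intro Y
    induction Y with
    | zero => simp [zetaGen]
    | add Y Z hY hZ =>
      rw [map_add, map_add, TensorProduct.add_tmul, map_add, ← hY, ← hZ, ← map_add]
      simp [zetaGen, TensorProduct.add_tmul, TensorProduct.tmul_add]
    | tmul a h =>
      rw [zetaGen_proj_tmul hδ hW hcc hA hσ h₃ hsplit hretr, ← LinearMap.comp_apply,
        ← LinearMap.rTensor_comp, ← LinearMap.comp_assoc, hΘ,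
        nabla_mulU1_tmul_one hδ hW hcc hA]
  have h := congrArg (LinearMap.rTensor H Θ) hX
  rw [hζ, crossCoact_proj hδ hsplit hretr, ← LinearMap.comp_apply, ← LinearMap.rTensor_comp, hΘ,
    ← nabla_eq_rTensor_mulU1 hδ] at h
  have h' := congrArg p h
  rw [proj_nabla hsplit hretr, proj_nabla hsplit hretr] at h'
  exact h'.symm

theorem crossInc_injective (hδ : W.δ = comul) (hW : IsWeakHopf W) (hA : IsWeakModAlg W φ)
    (hsplit : ι ∘ₗ p = nabla W φ) : Function.Injective (crossInc p) := by
  refine Function.LeftInverse.injective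
    (g := fun x => TensorProduct.rid k A (LinearMap.lTensor A W.ε (ι x))) fun a => ?_
  have h : ι (crossInc p a) = nabla W φ (a ⊗ₜ 1) := LinearMap.congr_fun hsplit _
  simp only [h, counit_nabla hδ hW, mulU1_tmul]
  exact (congrArg (a * ·) (hA.1 1)).trans (mul_one a)

theorem crossInc_mul (hδ : W.δ = comul) (hW : IsWeakHopf W) (hcc : Cocomm W)
    (hA : IsWeakModAlg W φ) (hσ : IsRegPair2 W φ σ σinv) (h₃ : CrossedG3 W φ σ)
    (hsplit : ι ∘ₗ p = nabla W φ) (hretr : p ∘ₗ ι = LinearMap.id) (a b : A) :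
    crossInc p (a * b) = crossMul W φ σ p ι (crossInc p a ⊗ₜ crossInc p b) := by
  have hinc : ∀ a : A, crossInc p a = p (a ⊗ₜ 1) := fun _ => rfl
  have ha : a ⊗ₜ[k] (1 : H) = inclA k H A a * (1 ⊗ₜ 1) := by simp
  have h := crossmulAmb_one_left hδ hW hcc hA hσ h₃ (b ⊗ₜ[k] (1 : H))
  rw [hinc, hinc, hinc, crossMul_proj hδ hA hσ hsplit, ha, crossmulAmb_inclA_mul, h,
    nabla_tmul hδ, ← mul_assoc, ← map_mul, ← nabla_tmul hδ, proj_nabla hsplit hretr]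

end CrossedProduct

/-- Let `H` be a cocommutative weak Hopf algebra and
`(φ, σ)` a crossed system for `H` over `A`.  Then the weak crossed product
`A ×_σ H` (realized as a splitting `(P, p, ι)` of the idempotent `∇_{A⊗H}`)
is an associative unital algebra which is a right `H`-comodule algebra for
`ρ_{A×H} = (p⊗H)∘(A⊗δ_H)∘ι`, and `i_{A×H} = p∘(A⊗η_H) : A → A×_σH` is an
injective algebra morphism whose image is exactly the coinvariants. -/
theorem statement10 {k H A P : Type} [CommRing k] [Ring H] [Algebra k H]
    [Ring A] [Algebra k A] [AddCommGroup P] [Module k P]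
    (W : HopfData k H) (hW : IsWeakHopf W) (hcc : Cocomm W)
    (φ : H ⊗[k] A →ₗ[k] A) (σ σinv : H ⊗[k] H →ₗ[k] A)
    (hcs : IsCrossedSystem W φ σ σinv)
    (p : A ⊗[k] H →ₗ[k] P) (ι : P →ₗ[k] A ⊗[k] H)
    (hsplit : ι ∘ₗ p = nabla W φ) (hretr : p ∘ₗ ι = LinearMap.id) :
    -- `A ×_σ H` is an associative unital algebra:
    (∀ x y z : P, crossMul W φ σ p ι (crossMul W φ σ p ι (x ⊗ₜ[k] y) ⊗ₜ[k] z) =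
        crossMul W φ σ p ι (x ⊗ₜ[k] crossMul W φ σ p ι (y ⊗ₜ[k] z))) ∧
    (∀ x : P, crossMul W φ σ p ι (crossUnit W φ p ⊗ₜ[k] x) = x ∧
        crossMul W φ σ p ι (x ⊗ₜ[k] crossUnit W φ p) = x) ∧
    -- it is a right `H`-comodule algebra for `ρ_{A×H}`:
    (∀ x : P, (TensorProduct.rid k P)
        ((LinearMap.lTensor P W.ε) (crossCoact W p ι x)) = x) ∧
    (∀ x : P, (TensorProduct.assoc k P H H)
        ((LinearMap.rTensor H (crossCoact W p ι)) (crossCoact W p ι x)) =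
      (LinearMap.lTensor P W.δ) (crossCoact W p ι x)) ∧
    (∀ x y : P, crossCoact W p ι (crossMul W φ σ p ι (x ⊗ₜ[k] y)) =
      (TensorProduct.map (crossMul W φ σ p ι) (LinearMap.mul' k H))
        ((TensorProduct.tensorTensorTensorComm k P H P H)
          (crossCoact W p ι x ⊗ₜ[k] crossCoact W p ι y))) ∧
    ((LinearMap.lTensor P (PiL W)) (crossCoact W p ι (crossUnit W φ p)) =
        crossCoact W p ι (crossUnit W φ p)) ∧
    -- `i_{A×H}` is an injective algebra morphism onto the coinvariants:
    Function.Injective (crossInc p) ∧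
    (∀ a b : A, crossInc p (a * b) =
        crossMul W φ σ p ι (crossInc p a ⊗ₜ[k] crossInc p b)) ∧
    (crossInc p (1 : A) = crossUnit W φ p) ∧
    (∀ x : P, (crossCoact W p ι x =
        zetaGen (crossMul W φ σ p ι) (crossCoact W p ι (crossUnit W φ p)) x) ↔
      x ∈ Set.range (crossInc p)) := by
  let _ := hW.toCoalgebra
  have hδ : W.δ = Coalgebra.comul := rfl
  obtain ⟨hA, hσ, -, -, h₃⟩ := id hcs
  have hp : Function.Surjective p := fun x => ⟨ι x, LinearMap.congr_fun hretr x⟩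
  have hunit : crossUnit W φ p = p (1 ⊗ₜ 1) := proj_nabla hsplit hretr _
  have hmul := crossMul_proj (σ := σ) hδ hA hσ hsplit
  rw [hunit]
  refine ⟨?_, ?_, ?_, ?_, ?_, lTensor_PiL_crossCoact_one hδ hW hsplit hretr,
    crossInc_injective hδ hW hA hsplit, crossInc_mul hδ hW hcc hA hσ h₃ hsplit hretr, rfl, ?_⟩
  · refine hp.forall₃.2 fun X Y Z => ?_
    rw [hmul, hmul, hmul, hmul, crossmulAmb_assoc hδ rfl hW hcs]
  · refine hp.forall.2 fun X => ?_
    rw [hmul, hmul, crossmulAmb_one_left hδ hW hcc hA hσ h₃,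
      crossmulAmb_one_right hδ hW hcc hA hσ h₃, proj_nabla hsplit hretr]
    exact ⟨rfl, rfl⟩
  · exact hp.forall.2 (crossCoact_counit hδ hW hsplit hretr)
  · exact hp.forall.2 (crossCoact_coassoc hδ hW hsplit hretr)
  · exact hp.forall₂.2 (crossCoact_mul hδ hW hA hσ hsplit hretr)
  · refine hp.forall.2 fun X =>
      ⟨fun hX => ⟨_, eq_crossInc_of_coinv hδ hW hcc hA hσ h₃ hsplit hretr X hX⟩, ?_⟩
    rintro ⟨a, ha⟩
    rw [← ha]
    change crossCoact W p ι (p (a ⊗ₜ 1)) = zetaGen _ _ (p (a ⊗ₜ 1))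
    rw [zetaGen_proj_tmul hδ hW hcc hA hσ h₃ hsplit hretr, crossCoact_proj hδ hsplit hretr,
      crossCoact_tmul, LinearMap.mulRight_one, LinearMap.comp_id]

end WHA

end
end
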